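/- arXiv:1204.4753 — 3 statements merged into one kernel-verified Lean document; each statement's English description precedes it below -/
import Mathlib

section
/- There exist a constant γ > 0 and an integer N such that for every n ≥ N there is a vector c ∈ {0, 1, …, 2^{⌊n/16⌋}}^n for which the polytope P = conv({x ∈ {0,1}^n : c·x ≤ ‖c‖₁/2} ∪ {(3/4, …, 3/4)}) ⊆ [0,1]^n has Chvátal rank at least γ·n². -/
open Finset

/-- The Gomory–Chvátal cut of `P` induced by the integer vector `c`:
`{x : c·x ≤ ⌊sup {c·y : y ∈ P}⌋}`. -/
noncomputable def gcCut {n : ℕ} (P : Set (Fin n → ℝ)) (c : Fin n → ℤ) : Set (Fin n → ℝ) :=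
  {x | ∑ i, (c i : ℝ) * x i ≤ (⌊sSup ((fun y => ∑ i, (c i : ℝ) * y i) '' P)⌋ : ℝ)}

/-- The Gomory–Chvátal closure `P' = ⋂_{c ∈ ℤⁿ} GC_P(c)`. -/
noncomputable def gcClosure {n : ℕ} (P : Set (Fin n → ℝ)) : Set (Fin n → ℝ) :=
  ⋂ c : Fin n → ℤ, gcCut P c

/-- Iterated Gomory–Chvátal closure: `P⁽⁰⁾ = P`, `P⁽ᵗ⁺¹⁾ = (P⁽ᵗ⁾)'`. -/
noncomputable def gcIter {n : ℕ} (P : Set (Fin n → ℝ)) : ℕ → Set (Fin n → ℝ)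
  | 0 => P
  | t + 1 => gcClosure (gcIter P t)

/-- The integer hull `P_I = conv(P ∩ ℤⁿ)`. -/
def integerHull {n : ℕ} (P : Set (Fin n → ℝ)) : Set (Fin n → ℝ) :=
  convexHull ℝ {x | x ∈ P ∧ ∀ i, ∃ z : ℤ, x i = (z : ℝ)}

/-- The feasible points of the 0/1 knapsack with weights `c` and capacity half the total weight. -/
def halfKnapsack {ι : Type*} [Fintype ι] (c : ι → ℝ) : Set (ι → ℝ) :=
  {x | (∀ i, x i = 0 ∨ x i = 1) ∧ ∑ i, c i * x i ≤ (∑ i, c i) / 2}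

section Rounding

variable {ι : Type*} [DecidableEq ι]

/-- The coordinates in `S` at which `x` is neither `0` nor `1`. -/
noncomputable def fracCoords (S : Finset ι) (x : ι → ℝ) : Finset ι :=
  {i ∈ S | x i ≠ 0 ∧ x i ≠ 1}

/-- The direction increasing coordinate `i` and decreasing coordinate `j`, orthogonal to `c`. -/
noncomputable def exchange (c : ι → ℝ) (i j : ι) : ι → ℝ :=
  Pi.single i (c i)⁻¹ - Pi.single j (c j)⁻¹

lemma exists_exchange {c : ι → ℝ} {S : Finset ι} {x : ι → ℝ}
    (hx : ∀ l ∈ S, 0 ≤ x l ∧ x l ≤ 1) {i j : ι} (hci : 0 < c i) (hcj : 0 < c j)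
    (hi : i ∈ fracCoords S x) (hj : j ∈ fracCoords S x) (hij : i ≠ j) :
    ∃ t : ℝ, 0 < t ∧
      (∀ l ∈ S, 0 ≤ (x + t • exchange c i j) l ∧ (x + t • exchange c i j) l ≤ 1) ∧
      (∀ l ∉ S, (x + t • exchange c i j) l = x l) ∧
      #(fracCoords S (x + t • exchange c i j)) < #(fracCoords S x) := by
  simp only [fracCoords, mem_filter] at hi hj
  obtain ⟨hiS, hi0, hi1⟩ := hi
  obtain ⟨hjS, hj0, hj1⟩ := hj
  have hxi : x i < 1 := lt_of_le_of_ne (hx i hiS).2 hi1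
  have hxj : 0 < x j := lt_of_le_of_ne (hx j hjS).1 (Ne.symm hj0)
  set t := min (c i * (1 - x i)) (c j * x j) with ht
  have ht0 : 0 < t := lt_min (mul_pos hci (by linarith)) (mul_pos hcj hxj)
  have hti : t * (c i)⁻¹ ≤ 1 - x i := by
    rw [← div_eq_mul_inv, div_le_iff₀ hci]
    linarith [min_le_left (c i * (1 - x i)) (c j * x j)]
  have htj : t * (c j)⁻¹ ≤ x j := by
    rw [← div_eq_mul_inv, div_le_iff₀ hcj]
    linarith [min_le_right (c i * (1 - x i)) (c j * x j)]
  have hti0 : 0 < t * (c i)⁻¹ := by positivity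
  have htj0 : 0 < t * (c j)⁻¹ := by positivity
  have vi : (x + t • exchange c i j) i = x i + t * (c i)⁻¹ := by
    simp [exchange, hij]
  have vj : (x + t • exchange c i j) j = x j - t * (c j)⁻¹ := by
    simp [exchange, hij.symm, sub_eq_add_neg]
  have vl : ∀ l, l ≠ i → l ≠ j → (x + t • exchange c i j) l = x l := by
    intro l h1 h2
    simp [exchange, h1, h2]
  refine ⟨t, ht0, ?_, ?_, ?_⟩
  · intro l hl
    by_cases h1 : l = i
    · subst h1
      rw [vi]
      constructor <;> linarith [(hx l hl).1]
    by_cases h2 : l = j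
    · subst h2
      rw [vj]
      constructor <;> linarith [(hx l hl).2]
    rw [vl l h1 h2]
    exact hx l hl
  · intro l hl
    exact vl l (fun h => hl (h ▸ hiS)) (fun h => hl (h ▸ hjS))
  · apply Finset.card_lt_card
    rw [Finset.ssubset_iff_of_subset]
    · rcases min_choice (c i * (1 - x i)) (c j * x j) with h | h
      · refine ⟨i, by simp [fracCoords, hiS, hi0, hi1], ?_⟩
        have : (x + t • exchange c i j) i = 1 := by
          rw [vi, ht, h]
          field_simp
          ring
        simp only [fracCoords, mem_filter, this]
        simp
      · refine ⟨j, by simp [fracCoords, hjS, hj0, hj1], ?_⟩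
        have : (x + t • exchange c i j) j = 0 := by
          rw [vj, ht, h]
          field_simp
          ring
        simp only [fracCoords, mem_filter, this]
        simp
    · intro l hl
      simp only [fracCoords, mem_filter] at hl ⊢
      by_cases h1 : l = i
      · subst h1
        exact ⟨hiS, hi0, hi1⟩
      by_cases h2 : l = j
      · subst h2
        exact ⟨hjS, hj0, hj1⟩
      rwa [vl l h1 h2] at hl

variable [Fintype ι]

lemma sum_mul_exchange {c : ι → ℝ} {i j : ι} (hi : 0 < c i) (hj : 0 < c j) :
    ∑ l, c l * exchange c i j l = 0 := by
  simp [exchange, mul_sub, Finset.sum_sub_distrib, Pi.single_apply, hi.ne', hj.ne']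

/-- Pipage rounding: a point of the cube is a convex combination of points of the same weight
with at most one fractional coordinate in `S`, all agreeing with it outside `S`. -/
lemma mem_convexHull_fracCoords_le_one {c : ι → ℝ} (hc : ∀ i, 0 < c i) (S : Finset ι)
    (x : ι → ℝ) (hx : ∀ l ∈ S, 0 ≤ x l ∧ x l ≤ 1) :
    x ∈ convexHull ℝ {y : ι → ℝ | (∀ l ∈ S, 0 ≤ y l ∧ y l ≤ 1) ∧ (∀ l ∉ S, y l = x l) ∧
      ∑ l, c l * y l = ∑ l, c l * x l ∧ #(fracCoords S y) ≤ 1} := by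
  induction hN : #(fracCoords S x) using Nat.strong_induction_on generalizing x with
  | _ N ih =>
  by_cases h1 : #(fracCoords S x) ≤ 1
  · exact subset_convexHull ℝ _ ⟨hx, fun _ _ => rfl, rfl, h1⟩
  obtain ⟨i, hi, j, hj, hij⟩ := Finset.one_lt_card.mp (not_le.mp h1)
  have step : ∀ i j, i ∈ fracCoords S x → j ∈ fracCoords S x → i ≠ j → ∃ t : ℝ, 0 < t ∧
      x + t • exchange c i j ∈
        convexHull ℝ {y : ι → ℝ | (∀ l ∈ S, 0 ≤ y l ∧ y l ≤ 1) ∧ (∀ l ∉ S, y l = x l) ∧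
          ∑ l, c l * y l = ∑ l, c l * x l ∧ #(fracCoords S y) ≤ 1} := by
    intro i j hi hj hij
    obtain ⟨t, ht, hbox, hoff, hcard⟩ := exists_exchange hx (hc i) (hc j) hi hj hij
    refine ⟨t, ht, ?_⟩
    refine convexHull_mono ?_ (ih _ (hN ▸ hcard) _ hbox rfl)
    rintro y ⟨h1, h2, h3, h4⟩
    refine ⟨h1, fun l hl => (h2 l hl).trans (hoff l hl), ?_, h4⟩
    rw [h3]
    have := sum_mul_exchange (hc i) (hc j)
    simp only [Pi.add_apply, Pi.smul_apply, smul_eq_mul, mul_add, sum_add_distrib]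
    rw [add_eq_left, ← mul_zero t, ← this, mul_sum]
    exact sum_congr rfl fun _ _ => by ring
  obtain ⟨t, ht, hmt⟩ := step i j hi hj hij
  obtain ⟨s, hs, hms⟩ := step j i hj hi hij.symm
  have hneg : exchange c j i = -exchange c i j := by simp [exchange]
  have hconv := (convex_convexHull ℝ _) hmt hms (a := s / (s + t)) (b := t / (s + t))
    (by positivity) (by positivity) (by field_simp)
  convert hconv using 1
  rw [hneg]
  ext l
  simp only [Pi.add_apply, Pi.smul_apply, smul_eq_mul, Pi.neg_apply]
  field_simp
  ring

/-- Points of weight `∑ c z` that are integral below level `s`, lie in the unit interval on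
level `s`, and agree with `z` above level `s`. -/
def partiallyRounded (c : ι → ℝ) (lvl : ι → ℕ) (z : ι → ℝ) (s : ℕ) : Set (ι → ℝ) :=
  {x | (∀ i, lvl i < s → x i = 0 ∨ x i = 1) ∧ (∀ i, lvl i = s → 0 ≤ x i ∧ x i ≤ 1) ∧
    (∀ i, s < lvl i → x i = z i) ∧ ∑ i, c i * x i = ∑ i, c i * z i}

/-- If every point that is integral on levels `≤ s`, and every pair of roundings of a point with a
single fractional coordinate on levels `≤ s`, is covered by a convex set, then so is every partially
rounded point. -/
lemma partiallyRounded_subset_of_convex {c : ι → ℝ} (hc : ∀ i, 0 < c i) {lvl : ι → ℕ}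
    {z : ι → ℝ} {s : ℕ} {T : Set (ι → ℝ)} (hT : Convex ℝ T)
    (hbin : ∀ x : ι → ℝ, (∀ i, lvl i ≤ s → x i = 0 ∨ x i = 1) → (∀ i, s < lvl i → x i = z i) →
      ∑ i, c i * x i = ∑ i, c i * z i → x ∈ T)
    (hfrac : ∀ (x : ι → ℝ) (j : ι), lvl j = s → 0 < x j → x j < 1 →
      (∀ i, i ≠ j → lvl i ≤ s → x i = 0 ∨ x i = 1) → (∀ i, s < lvl i → x i = z i) →
      ∑ i, c i * x i = ∑ i, c i * z i →
      ∃ u : ι → ℝ, x - x j • u ∈ T ∧ x + (1 - x j) • u ∈ T) :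
    partiallyRounded c lvl z s ⊆ T := by
  rintro x ⟨hlt, heq, hgt, hsum⟩
  have hmem := mem_convexHull_fracCoords_le_one hc ({i | lvl i = s} : Finset ι) x
    (by simpa using heq)
  refine convexHull_min ?_ hT hmem
  rintro y ⟨hbox, hoff, hsumy, hcard⟩
  simp only [mem_filter, mem_univ, true_and] at hbox hoff
  have hltx : ∀ i, lvl i < s → y i = 0 ∨ y i = 1 := fun i hi => by
    rw [hoff i hi.ne]
    exact hlt i hi
  have hgty : ∀ i, s < lvl i → y i = z i := fun i hi => by
    rw [hoff i hi.ne']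
    exact hgt i hi
  rcases Nat.le_one_iff_eq_zero_or_eq_one.mp hcard with h0 | h1
  · refine hbin y (fun i hi => ?_) hgty (hsumy.trans hsum)
    rcases hi.lt_or_eq with h | h
    · exact hltx i h
    · rw [Finset.card_eq_zero] at h0
      by_contra hcon
      have : i ∈ fracCoords ({i | lvl i = s} : Finset ι) y := by
        simp only [fracCoords, mem_filter, mem_univ, true_and]
        exact ⟨h, by tauto⟩
      simp [h0] at this
  · obtain ⟨j, hj⟩ := Finset.card_eq_one.mp h1
    have hjm : j ∈ fracCoords ({i | lvl i = s} : Finset ι) y := by simp [hj]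
    simp only [fracCoords, mem_filter, mem_univ, true_and] at hjm
    obtain ⟨hjs, hj0, hj1⟩ := hjm
    have p0 : 0 < y j := lt_of_le_of_ne (hbox j hjs).1 (Ne.symm hj0)
    have p1 : y j < 1 := lt_of_le_of_ne (hbox j hjs).2 hj1
    obtain ⟨u, hu0, hu1⟩ := hfrac y j hjs p0 p1 (fun i hij hi => by
      rcases hi.lt_or_eq with h | h
      · exact hltx i h
      · by_contra hcon
        have : i ∈ fracCoords ({i | lvl i = s} : Finset ι) y := by
          simp only [fracCoords, mem_filter, mem_univ, true_and]
          exact ⟨h, by tauto⟩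
        rw [hj, mem_singleton] at this
        exact hij this) hgty (hsumy.trans hsum)
    have := hT hu0 hu1 (a := 1 - y j) (b := y j) (by linarith) p0.le (by ring)
    convert this using 1
    ext l
    simp only [Pi.add_apply, Pi.sub_apply, Pi.smul_apply, smul_eq_mul]
    ring

lemma partiallyRounded_subset_succ {c : ι → ℝ} (hc : ∀ i, 0 < c i) {lvl : ι → ℕ}
    {z : ι → ℝ} (hz : ∀ i, 1 / 4 ≤ z i ∧ z i ≤ 3 / 4) {s : ℕ} {w : ℝ} (hw : 0 < w)
    (hle : ∀ i, lvl i = s → c i ≤ 2 * w) (heq : ∀ i, lvl i = s + 1 → c i = w)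
    (hcard : #{i | lvl i = s + 1} = 8) :
    partiallyRounded c lvl z s ⊆ convexHull ℝ (partiallyRounded c lvl z (s + 1)) := by
  refine partiallyRounded_subset_of_convex hc (convex_convexHull ℝ _) ?_ ?_
  · intro x h1 h2 h3
    refine subset_convexHull ℝ _ ⟨fun i hi => h1 i (by omega), fun i hi => ?_,
      fun i hi => h2 i (by omega), h3⟩
    rw [h2 i (by omega)]
    constructor <;> linarith [(hz i).1, (hz i).2]
  · intro x j hjs hj0 hj1 hbin hgt hsum
    set r := c j / (8 * w) with hr
    have hr0 : 0 ≤ r := div_nonneg (hc j).le (by linarith)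
    have hr1 : r ≤ 1 / 4 := by
      rw [hr, div_le_iff₀ (by linarith)]
      linarith [hle j hjs]
    let u : ι → ℝ := fun i => (if i = j then 1 else 0) - (if lvl i = s + 1 then r else 0)
    have hu : ∑ i, c i * u i = 0 := by
      have : ∑ i, c i * (if lvl i = s + 1 then r else 0) = 8 * (w * r) := by
        simp only [mul_ite, mul_zero]
        rw [← Finset.sum_filter, Finset.sum_congr rfl (g := fun _ => w * r), Finset.sum_const,
          hcard]
        · simp
        · intro i hi
          rw [heq i (by simpa using hi)]
      simp only [u, mul_sub, Finset.sum_sub_distrib, this]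
      simp [hr]
      field_simp
      ring
    have key : ∀ τ : ℝ, (τ = 0 ∨ τ = 1) →
        x + (τ - x j) • u ∈ partiallyRounded c lvl z (s + 1) := by
      intro τ hτ
      have habs : -1 ≤ τ - x j ∧ τ - x j ≤ 1 := by
        rcases hτ with h | h <;> subst h <;> constructor <;> linarith
      refine ⟨fun i hi => ?_, fun i hi => ?_, fun i hi => ?_, ?_⟩
      · by_cases hij : i = j
        · subst hij
          have : (x + (τ - x i) • u) i = τ := by simp [u, hjs]
          rw [this]
          exact hτ
        · have : (x + (τ - x j) • u) i = x i := by simp [u, hij, hi.ne]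
          rw [this]
          exact hbin i hij (by omega)
      · have hij : i ≠ j := by
          rintro rfl
          omega
        have : (x + (τ - x j) • u) i = z i - (τ - x j) * r := by
          simp [u, hij, hi, hgt i (by omega), sub_eq_add_neg]
        rw [this]
        constructor <;> nlinarith [hz i]
      · have hij : i ≠ j := by
          rintro rfl
          omega
        have : (x + (τ - x j) • u) i = x i := by
          simp [u, hij, hi.ne']
        rw [this]
        exact hgt i (by omega)
      · simp only [Pi.add_apply, Pi.smul_apply, smul_eq_mul, mul_add, sum_add_distrib]
        rw [hsum, add_eq_left, ← mul_zero (τ - x j), ← hu, mul_sum]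
        exact sum_congr rfl fun _ _ => by ring
    refine ⟨u, subset_convexHull ℝ _ ?_, subset_convexHull ℝ _ (key 1 (Or.inr rfl))⟩
    have := key 0 (Or.inl rfl)
    rwa [zero_sub, neg_smul, ← sub_eq_add_neg] at this

lemma partiallyRounded_last_subset {c : ι → ℝ} (hc : ∀ i, 0 < c i) {lvl : ι → ℕ}
    {z : ι → ℝ} {k : ℕ} (hlvl : ∀ i, lvl i ≤ k) (hle : ∀ i, lvl i = k → c i ≤ 1)
    (hcz : ∑ i, c i * z i ≤ (∑ i, c i) / 2 - 1) :
    partiallyRounded c lvl z k ⊆ convexHull ℝ (halfKnapsack c) := by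
  refine partiallyRounded_subset_of_convex hc (convex_convexHull ℝ _) ?_ ?_
  · intro x h1 _ h3
    exact subset_convexHull ℝ _ ⟨fun i => h1 i (hlvl i), by linarith⟩
  · intro x j hjk hj0 hj1 hbin _ hsum
    have key : ∀ τ : ℝ, (τ = 0 ∨ τ = 1) →
        x + (τ - x j) • (Pi.single j 1 : ι → ℝ) ∈ halfKnapsack c := by
      intro τ hτ
      have habs : τ - x j ≤ 1 := by
        rcases hτ with h | h <;> subst h <;> linarith
      refine ⟨fun i => ?_, ?_⟩
      · by_cases hij : i = j
        · subst hij
          simpa using hτ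
        · simpa [hij] using hbin i hij (hlvl i)
      · simp only [Pi.add_apply, Pi.smul_apply, smul_eq_mul, mul_add, sum_add_distrib, hsum]
        have : ∑ i, c i * ((τ - x j) * (Pi.single j 1 : ι → ℝ) i) = c j * (τ - x j) := by
          simp [Pi.single_apply]
        rw [this]
        nlinarith [hc j, hle j hjk]
    refine ⟨Pi.single j 1, subset_convexHull ℝ _ ?_,
      subset_convexHull ℝ _ (key 1 (Or.inr rfl))⟩
    have := key 0 (Or.inl rfl)
    rwa [zero_sub, neg_smul, ← sub_eq_add_neg] at this

/-- Weights organised in levels: weights on level `s` are at most `2 ^ (k - s)`, and each positive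
level `s ≤ k` consists of eight weights equal to `2 ^ (k - s)`. -/
structure DyadicLevels (c : ι → ℝ) (lvl : ι → ℕ) (k : ℕ) : Prop where
  pos : ∀ i, 0 < c i
  lvl_le : ∀ i, lvl i ≤ k
  le_pow : ∀ i, c i ≤ 2 ^ k / 2 ^ lvl i
  eq_pow : ∀ i, 0 < lvl i → c i = 2 ^ k / 2 ^ lvl i
  card_lvl : ∀ s, 0 < s → s ≤ k → #{i | lvl i = s} = 8

lemma DyadicLevels.mem_convexHull_halfKnapsack {c : ι → ℝ} {lvl : ι → ℕ} {k : ℕ}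
    (h : DyadicLevels c lvl k) {z : ι → ℝ} (hz : ∀ i, 1 / 4 ≤ z i ∧ z i ≤ 3 / 4)
    (hcz : ∑ i, c i * z i ≤ (∑ i, c i) / 2 - 1) :
    z ∈ convexHull ℝ (halfKnapsack c) := by
  have hmem : ∀ s ≤ k, z ∈ convexHull ℝ (partiallyRounded c lvl z s) := by
    intro s
    induction s with
    | zero =>
      intro _
      refine subset_convexHull ℝ _ ⟨fun i hi => absurd hi (Nat.not_lt_zero _), fun i _ => ?_,
        fun _ _ => rfl, rfl⟩
      constructor <;> linarith [(hz i).1, (hz i).2]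
    | succ s ih =>
      intro hs
      refine convexHull_min ?_ (convex_convexHull ℝ _) (ih (by omega))
      refine partiallyRounded_subset_succ h.pos hz (w := 2 ^ k / 2 ^ (s + 1)) (by positivity)
        (fun i hi => ?_) (fun i hi => ?_) (h.card_lvl _ (by omega) hs)
      · have := h.le_pow i
        rw [hi] at this
        refine this.trans (le_of_eq ?_)
        rw [pow_succ]
        field_simp
      · rw [h.eq_pow i (by omega), hi]
  refine convexHull_min ?_ (convex_convexHull ℝ _) (hmem k le_rfl)
  refine partiallyRounded_last_subset h.pos h.lvl_le (fun i hi => ?_) hcz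
  have := h.le_pow i
  rwa [hi, div_self (by positivity)] at this

end Rounding

section Critical

variable {ι : Type*} [Fintype ι]

lemma sum_mul_le_of_mem_convexHull {d : ι → ℝ} {K : Set (ι → ℝ)} {V : ℝ}
    (hV : ∀ x ∈ K, ∑ i, d i * x i ≤ V) {z : ι → ℝ} (hz : z ∈ convexHull ℝ K) :
    ∑ i, d i * z i ≤ V := by
  have hlin : IsLinearMap ℝ fun x : ι → ℝ => ∑ i, d i * x i :=
    ⟨fun x y => by simp [mul_add, sum_add_distrib], fun a x => by
      simp only [Pi.smul_apply, smul_eq_mul, mul_sum]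
      exact sum_congr rfl fun _ _ => by ring⟩
  exact convexHull_min (show K ⊆ {x : ι → ℝ | ∑ i, d i * x i ≤ V} from hV)
    (convex_halfSpace_le hlin V) hz

variable [DecidableEq ι]

lemma DyadicLevels.le_of_forall_halfKnapsack {c : ι → ℝ} {lvl : ι → ℕ} {k : ℕ}
    (h : DyadicLevels c lvl k) (hC : 8 ≤ ∑ i, c i) {d : ι → ℝ} {V : ℝ}
    (hV : ∀ x ∈ halfKnapsack c, ∑ i, d i * x i ≤ V) :
    (∑ i, d i) * (1 / 2 - 1 / ∑ i, c i) ≤ V := by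
  set C := ∑ i, c i with hCdef
  have hCinv : 1 / C ≤ 1 / 8 := one_div_le_one_div_of_le (by norm_num) hC
  have hCpos : 0 < 1 / C := by positivity
  have := sum_mul_le_of_mem_convexHull hV (h.mem_convexHull_halfKnapsack
    (z := fun _ => 1 / 2 - 1 / C) (fun _ => by constructor <;> linarith) ?_)
  · rwa [← sum_mul] at this
  · rw [← sum_mul, ← hCdef]
    field_simp
    linarith

/-- A functional `d` whose maximum over the knapsack is close to half its total is close in
`ℓ₁` to a multiple of the weights. -/
lemma DyadicLevels.sum_abs_sub_le {c : ι → ℝ} {lvl : ι → ℕ} {k : ℕ}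
    (h : DyadicLevels c lvl k) (hC : 8 ≤ ∑ i, c i) {d : ι → ℝ} {V : ℝ}
    (hV : ∀ x ∈ halfKnapsack c, ∑ i, d i * x i ≤ V) :
    ∑ i, |d i - (∑ i, d i) / (∑ i, c i) * c i| ≤
      16 * (V - (∑ i, d i) / 2 + (∑ i, d i) / ∑ i, c i) := by
  set C := ∑ i, c i with hCdef
  set D := ∑ i, d i with hDdef
  have hC0 : 0 < C := by linarith
  have hCinv : 1 / C ≤ 1 / 8 := one_div_le_one_div_of_le (by norm_num) hC
  have hCpos : 0 < 1 / C := by positivity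
  set e : ι → ℝ := fun i => d i - D / C * c i with he
  have hesum : ∑ i, e i = 0 := by
    simp only [he, sum_sub_distrib, ← mul_sum]
    rw [← hCdef, ← hDdef]
    field_simp
    ring
  set P := ∑ i, if 0 < e i then c i else 0 with hP
  set N := ∑ i, if 0 < e i then 0 else c i with hN
  have hPN : P + N = C := by
    rw [hP, hN, hCdef, ← sum_add_distrib]
    exact sum_congr rfl fun i _ => by split_ifs <;> simp
  have hP0 : 0 ≤ P := sum_nonneg fun i _ => by
    split_ifs
    exacts [(h.pos i).le, le_rfl]
  have hN0 : 0 ≤ N := sum_nonneg fun i _ => by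
    split_ifs
    exacts [le_rfl, (h.pos i).le]
  set y : ι → ℝ := fun i => if 0 < e i then N / C / 8 else -(P / C / 8) with hy
  have hPC : P / C ≤ 1 := by rw [div_le_one hC0]; linarith
  have hNC : N / C ≤ 1 := by rw [div_le_one hC0]; linarith
  have hPC0 : 0 ≤ P / C := by positivity
  have hNC0 : 0 ≤ N / C := by positivity
  have hcy : ∑ i, c i * y i = 0 := by
    have : ∑ i, c i * y i = P * (N / C / 8) - N * (P / C / 8) := by
      rw [hP, hN, sum_mul, sum_mul, ← sum_sub_distrib]
      exact sum_congr rfl fun i _ => by simp only [hy]; split_ifs <;> ring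
    rw [this]
    ring
  have hey : ∑ i, e i * y i = (∑ i, |e i|) / 16 := by
    have h1 : ∀ i, e i * y i = |e i| / 16 + e i * ((N / C - P / C) / 16) := by
      intro i
      have hsum : P / C + N / C = 1 := by rw [← add_div, hPN, div_self hC0.ne']
      simp only [hy]
      split_ifs with hi
      · rw [abs_of_pos hi]
        linear_combination (e i / 16) * hsum
      · rw [abs_of_nonpos (not_lt.mp hi)]
        linear_combination (-(e i) / 16) * hsum
    simp only [h1, sum_add_distrib, ← sum_mul, hesum, zero_mul, add_zero, ← sum_div]
  have hdy : ∑ i, d i * y i = (∑ i, |e i|) / 16 := by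
    rw [← hey, ← add_zero (∑ i, e i * y i), ← mul_zero (D / C), ← hcy, mul_sum,
      ← sum_add_distrib]
    exact sum_congr rfl fun i _ => by simp only [he]; ring
  have hmem := h.mem_convexHull_halfKnapsack (z := fun i => 1 / 2 + y i - 1 / C) (fun i => by
      simp only [hy]
      split_ifs <;> constructor <;> linarith) (by
      simp only [mul_sub, mul_add, sum_sub_distrib, sum_add_distrib, hcy, ← sum_mul]
      rw [← hCdef]
      field_simp
      linarith)
  have hfin := sum_mul_le_of_mem_convexHull hV hmem
  simp only [mul_sub, mul_add, sum_sub_distrib, sum_add_distrib, hdy, ← sum_mul] at hfin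
  rw [← hDdef] at hfin
  have : D * (1 / C) = D / C := by ring
  linarith

end Critical

section Counting

variable {κ : Type*} [Fintype κ] [DecidableEq κ]

/-- Integer vectors of `ℓ₁`-norm at most `T`. -/
noncomputable def intBall (κ : Type*) [Fintype κ] [DecidableEq κ] (T : ℕ) : Finset (κ → ℤ) :=
  {v ∈ Fintype.piFinset fun _ => Finset.Icc (-(T : ℤ)) T | ∑ i, (v i).natAbs ≤ T}

lemma mem_intBall {T : ℕ} {v : κ → ℤ} : v ∈ intBall κ T ↔ ∑ i, (v i).natAbs ≤ T := by
  simp only [intBall, mem_filter, Fintype.mem_piFinset, Finset.mem_Icc, and_iff_right_iff_imp]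
  intro h i
  have : (v i).natAbs ≤ T :=
    (single_le_sum (f := fun i => (v i).natAbs) (fun _ _ => Nat.zero_le _) (mem_univ i)).trans h
  omega

lemma sum_Icc_pow_natAbs_le {x : ℝ} (hx0 : 0 ≤ x) (hx1 : x < 1) (T : ℕ) :
    ∑ k ∈ Finset.Icc (-(T : ℤ)) T, x ^ k.natAbs ≤ 2 * (1 - x)⁻¹ := by
  have hgeom : ∑ k ∈ range (T + 1), x ^ k ≤ (1 - x)⁻¹ :=
    (Summable.sum_le_tsum _ (fun _ _ => pow_nonneg hx0 _)
      (summable_geometric_of_lt_one hx0 hx1)).trans_eq (tsum_geometric_of_lt_one hx0 hx1)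
  have hsub : Finset.Icc (-(T : ℤ)) T ⊆
      (range (T + 1)).image (fun k : ℕ => (k : ℤ)) ∪
        (range (T + 1)).image (fun k : ℕ => -(k : ℤ)) := by
    intro k hk
    simp only [Finset.mem_Icc] at hk
    simp only [mem_union, mem_image, mem_range]
    rcases le_total 0 k with h | h
    · exact Or.inl ⟨k.natAbs, by omega, by omega⟩
    · exact Or.inr ⟨k.natAbs, by omega, by omega⟩
  calc ∑ k ∈ Finset.Icc (-(T : ℤ)) T, x ^ k.natAbs
      ≤ ∑ k ∈ (range (T + 1)).image (fun k : ℕ => (k : ℤ)) ∪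
          (range (T + 1)).image (fun k : ℕ => -(k : ℤ)), x ^ k.natAbs :=
        sum_le_sum_of_subset_of_nonneg hsub fun _ _ _ => pow_nonneg hx0 _
    _ ≤ ∑ k ∈ (range (T + 1)).image (fun k : ℕ => (k : ℤ)), x ^ k.natAbs +
          ∑ k ∈ (range (T + 1)).image (fun k : ℕ => -(k : ℤ)), x ^ k.natAbs := by
        rw [← sum_union_inter]
        exact le_add_of_nonneg_right (sum_nonneg fun _ _ => pow_nonneg hx0 _)
    _ ≤ 2 * (1 - x)⁻¹ := by
        rw [sum_image (by intro a _ b _ hab; simpa using hab),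
          sum_image (by intro a _ b _ hab; simpa using hab)]
        simp only [Int.natAbs_neg, Int.natAbs_natCast]
        linarith

lemma card_intBall_le {T b : ℕ} (hb : 0 < b) (hT : T ≤ b * Fintype.card κ) :
    (#(intBall κ T) : ℝ) ≤ (6 * (b + 1)) ^ Fintype.card κ := by
  have hb' : (0 : ℝ) < b := by exact_mod_cast hb
  set x : ℝ := b / (b + 1) with hx
  have hx0 : 0 < x := by positivity
  have hx1 : x < 1 := by
    rw [hx, div_lt_one (by positivity)]
    linarith
  have hinv : (1 - x)⁻¹ = b + 1 := by
    rw [hx]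
    field_simp
    ring
  have hxb : (x ^ b)⁻¹ ≤ 3 := by
    have : x⁻¹ ≤ Real.exp (1 / b) := by
      have h1 := Real.add_one_le_exp (1 / (b : ℝ))
      refine le_trans (le_of_eq ?_) h1
      rw [hx]
      field_simp
      ring
    calc (x ^ b)⁻¹ = x⁻¹ ^ b := by rw [inv_pow]
      _ ≤ Real.exp (1 / b) ^ b := by gcongr
      _ = Real.exp 1 := by
        rw [← Real.exp_nat_mul]
        congr 1
        field_simp
      _ ≤ 3 := by linarith [Real.exp_one_lt_d9]
  have hweight : ∀ v ∈ intBall κ T, (x ^ b) ^ Fintype.card κ ≤ ∏ i, x ^ (v i).natAbs := by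
    intro v hv
    rw [prod_pow_eq_pow_sum, ← pow_mul]
    exact pow_le_pow_of_le_one hx0.le hx1.le ((mem_intBall.mp hv).trans hT)
  have hsum : (#(intBall κ T) : ℝ) * (x ^ b) ^ Fintype.card κ ≤
      (2 * (b + 1)) ^ Fintype.card κ := by
    calc (#(intBall κ T) : ℝ) * (x ^ b) ^ Fintype.card κ
        ≤ ∑ v ∈ intBall κ T, ∏ i, x ^ (v i).natAbs := by
          rw [← nsmul_eq_mul]
          exact card_nsmul_le_sum _ _ _ hweight
      _ ≤ ∑ v ∈ Fintype.piFinset fun _ : κ => Finset.Icc (-(T : ℤ)) T,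
            ∏ i, x ^ (v i).natAbs :=
          sum_le_sum_of_subset_of_nonneg (filter_subset _ _)
            fun _ _ _ => prod_nonneg fun _ _ => pow_nonneg hx0.le _
      _ = ∏ _i : κ, ∑ k ∈ Finset.Icc (-(T : ℤ)) T, x ^ k.natAbs :=
          (prod_univ_sum (fun _ : κ => Finset.Icc (-(T : ℤ)) T)
            (fun _ k => x ^ k.natAbs)).symm
      _ ≤ ∏ _i : κ, (2 * (b + 1) : ℝ) := by
          refine prod_le_prod (fun _ _ => sum_nonneg fun _ _ => pow_nonneg hx0.le _) fun _ _ => ?_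
          rw [← hinv]
          exact sum_Icc_pow_natAbs_le hx0.le hx1 T
      _ = (2 * (b + 1)) ^ Fintype.card κ := by simp
  have hpos : 0 < (x ^ b) ^ Fintype.card κ := by positivity
  calc (#(intBall κ T) : ℝ)
      ≤ (2 * (b + 1)) ^ Fintype.card κ * ((x ^ b)⁻¹) ^ Fintype.card κ := by
        rw [inv_pow, ← div_eq_mul_inv, le_div_iff₀ hpos]
        exact hsum
    _ ≤ (2 * (b + 1)) ^ Fintype.card κ * 3 ^ Fintype.card κ := by gcongr
    _ = (6 * (b + 1)) ^ Fintype.card κ := by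
        rw [← mul_pow]
        congr 1
        ring

/-- A counting argument: some integer weight vector with entries in `[1, 2 ^ k]` is not
approximated in `ℓ₁` by any scaled integer vector of small norm. -/
lemma exists_badly_approximable {n k : ℕ} (hn : 0 < n)
    (hκ : n ≤ 2 * Fintype.card κ)
    (hcount : n * 2 ^ k * (n * 2 ^ k + 1) < 4 ^ Fintype.card κ) :
    ∃ g : κ → ℤ, (∀ i, 1 ≤ g i ∧ g i ≤ 2 ^ k) ∧
      ∀ D C : ℕ, 0 < D → C ≤ n * 2 ^ k → ∀ d : κ → ℤ, ∑ i, (d i).natAbs ≤ D →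
        ∀ ε : ℝ, 1 / 2 ^ k ≤ ε → ε ≤ 1 / 2 ^ 16 → D * ε < n / 2 ^ 16 →
          32 * ε * C < ∑ i, |(C : ℝ) / D * d i - g i| := by
  by_contra! hcon
  set N := Fintype.card κ with hN
  set A := n * 2 ^ k with hA
  have hn' : (0 : ℝ) < n := by exact_mod_cast hn
  have hN0 : 0 < N := by omega
  have hN' : (0 : ℝ) < N := by exact_mod_cast hN0
  have hκ' : (n : ℝ) ≤ 2 * N := by exact_mod_cast hκ
  have hAR : (A : ℝ) = n * 2 ^ k := by rw [hA]; push_cast; ring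
  let bd : ℕ → ℕ := fun D => max n D / N + 1
  let bv : ℕ → ℕ := fun D => A / (1024 * max n D) + 2
  let I : Finset (ℕ × ℕ) := {p ∈ Finset.Icc 1 A ×ˢ range (A + 1) | max n p.1 * 2 ^ 16 ≤ A}
  let F : ℕ × ℕ → Finset (κ → ℤ) := fun p =>
    (intBall κ p.1 ×ˢ intBall κ (bv p.1 * N)).image
      fun q i => q.2 i + ⌊(p.2 : ℝ) / p.1 * q.1 i⌋
  have hcover : (Fintype.piFinset fun _ : κ => Finset.Icc (1 : ℤ) (2 ^ k)) ⊆ I.biUnion F := by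
    intro g hg
    simp only [Fintype.mem_piFinset, Finset.mem_Icc] at hg
    obtain ⟨D, C, hD, hC, d, hd, ε, hε1, hε2, hDε, hle⟩ := hcon g hg
    have hD' : (0 : ℝ) < D := by exact_mod_cast hD
    have hεpos : 0 < ε := lt_of_lt_of_le (by positivity) hε1
    set m := max n D with hm
    have hmR : (m : ℝ) * ε ≤ n / 2 ^ 16 := by
      rcases max_choice n D with h | h
      · rw [hm, h]
        calc (n : ℝ) * ε ≤ n * (1 / 2 ^ 16) := by gcongr
          _ = n / 2 ^ 16 := by ring
      · rw [hm, h]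
        exact hDε.le
    have hm0 : 0 < m := lt_of_lt_of_le hn (le_max_left _ _)
    have hm' : (0 : ℝ) < m := by exact_mod_cast hm0
    have hmA : m * 2 ^ 16 ≤ A := by
      have h1 : (m : ℝ) * (1 / 2 ^ k) ≤ n / 2 ^ 16 :=
        (mul_le_mul_of_nonneg_left hε1 hm'.le).trans hmR
      have h2 : (m : ℝ) * 2 ^ 16 ≤ A := by
        rw [hAR]
        rw [mul_one_div, div_le_div_iff₀ (by positivity) (by positivity)] at h1
        exact h1
      exact_mod_cast h2
    have hDm : D ≤ m := le_max_right _ _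
    simp only [mem_biUnion]
    refine ⟨(D, C), ?_, ?_⟩
    · simp only [I, mem_filter, mem_product, Finset.mem_Icc, mem_range]
      exact ⟨⟨⟨hD, by omega⟩, by omega⟩, hmA⟩
    · simp only [F, mem_image, mem_product]
      refine ⟨(d, fun i => g i - ⌊(C : ℝ) / D * d i⌋), ⟨mem_intBall.mpr hd, ?_⟩, ?_⟩
      · rw [mem_intBall]
        have hterm : ∀ i, (((g i - ⌊(C : ℝ) / D * d i⌋).natAbs : ℕ) : ℝ) ≤
            |(C : ℝ) / D * d i - g i| + 1 := by
          intro i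
          rw [Nat.cast_natAbs]
          push_cast
          have h1 := Int.floor_le ((C : ℝ) / D * d i)
          have h2 := Int.lt_floor_add_one ((C : ℝ) / D * d i)
          have h3 := neg_abs_le ((C : ℝ) / D * d i - g i)
          have h4 := le_abs_self ((C : ℝ) / D * d i - g i)
          rw [abs_le]
          constructor <;> linarith
        have hCR : (C : ℝ) ≤ A := by exact_mod_cast hC
        have hq : (A : ℝ) / (1024 * m) ≤ (A / (1024 * m) : ℕ) + 1 := by
          have := (Nat.lt_floor_add_one ((A : ℝ) / ((1024 * m : ℕ) : ℝ))).le
          rw [Nat.floor_div_eq_div] at this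
          push_cast at this
          exact this
        have hεm : ε ≤ n / 2 ^ 16 / m := by
          rw [le_div_iff₀ hm']
          linarith
        have hreal : ((∑ i, (g i - ⌊(C : ℝ) / D * d i⌋).natAbs : ℕ) : ℝ) ≤
            ((bv D * N : ℕ) : ℝ) := by
          calc ((∑ i, (g i - ⌊(C : ℝ) / D * d i⌋).natAbs : ℕ) : ℝ)
              ≤ ∑ i, (|(C : ℝ) / D * d i - g i| + 1) := by
                rw [Nat.cast_sum]
                exact sum_le_sum fun i _ => hterm i
            _ = ∑ i, |(C : ℝ) / D * d i - g i| + N := by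
                rw [sum_add_distrib]
                simp [hN]
            _ ≤ 32 * ε * C + N := by linarith
            _ ≤ 32 * (n / 2 ^ 16 / m) * A + N := by gcongr
            _ ≤ 32 * (2 * N / 2 ^ 16 / m) * A + N := by gcongr
            _ = (A / (1024 * m) + 1) * N := by
                field_simp
                ring
            _ ≤ ((A / (1024 * m) : ℕ) + 1 + 1) * N := by gcongr
            _ = ((bv D * N : ℕ) : ℝ) := by
                simp only [bv]
                push_cast
                ring
        exact_mod_cast hreal
      · ext i
        simp
  have hF : ∀ p ∈ I, (#(F p) : ℝ) ≤ (2 ^ k / 4 : ℝ) ^ N := by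
    rintro ⟨D, C⟩ hp
    simp only [I, mem_filter, mem_product, Finset.mem_Icc, mem_range] at hp
    obtain ⟨⟨⟨hD, -⟩, -⟩, hmA⟩ := hp
    set m := max n D with hm
    have hm0 : 0 < m := lt_of_lt_of_le hn (le_max_left _ _)
    have hm' : (0 : ℝ) < m := by exact_mod_cast hm0
    have hnm : (n : ℝ) ≤ m := by exact_mod_cast le_max_left n D
    have hmA' : (m : ℝ) * 2 ^ 16 ≤ A := by exact_mod_cast hmA
    have h1 : (#(intBall κ D) : ℝ) ≤ (6 * (bd D + 1)) ^ N := by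
      refine card_intBall_le (Nat.succ_pos _) ?_
      have : m < (m / N + 1) * N := by
        have := Nat.lt_mul_div_succ m hN0
        linarith
      exact (le_max_right n D).trans this.le
    have h2 : (#(intBall κ (bv D * N)) : ℝ) ≤ (6 * (bv D + 1)) ^ N :=
      card_intBall_le (Nat.succ_pos _) le_rfl
    have hbd : (bd D : ℝ) + 1 ≤ 4 * m / n := by
      have h3 : ((m / N : ℕ) : ℝ) ≤ m / N := Nat.cast_div_le
      have h4 : (m : ℝ) / N ≤ 2 * m / n := by
        rw [div_le_div_iff₀ hN' hn']
        nlinarith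
      have h5 : (1 : ℝ) ≤ m / n := by rwa [one_le_div hn']
      simp only [bd]
      push_cast
      rw [← hm]
      have : 4 * (m : ℝ) / n = 2 * m / n + 2 * (m / n) := by ring
      linarith
    have hbv : (bv D : ℝ) + 1 ≤ 67 / 2 ^ 16 * (A / m) := by
      have h3 : ((A / (1024 * m) : ℕ) : ℝ) ≤ A / (1024 * m) := by
        have := Nat.cast_div_le (α := ℝ) (m := A) (n := 1024 * m)
        push_cast at this
        exact this
      have h4 : (2 ^ 16 : ℝ) ≤ A / m := by
        rw [le_div_iff₀ hm']
        linarith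
      have h5 : (A : ℝ) / (1024 * m) = A / m / 1024 := by field_simp
      simp only [bv]
      push_cast
      rw [← hm]
      rw [h5] at h3
      linarith
    calc (#(F (D, C)) : ℝ) ≤ (#(intBall κ D ×ˢ intBall κ (bv D * N)) : ℝ) := by
          exact_mod_cast card_image_le
      _ = #(intBall κ D) * #(intBall κ (bv D * N)) := by
          rw [card_product]
          push_cast
          rfl
      _ ≤ (6 * (bd D + 1)) ^ N * (6 * (bv D + 1)) ^ N := by gcongr
      _ = (6 * (bd D + 1) * (6 * (bv D + 1))) ^ N := by rw [mul_pow (6 * ((bd D : ℝ) + 1))]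
      _ ≤ (6 * (4 * m / n) * (6 * (67 / 2 ^ 16 * (A / m)))) ^ N := by gcongr
      _ = (9648 / 2 ^ 16 * 2 ^ k : ℝ) ^ N := by
          rw [hAR]
          congr 1
          field_simp
          ring
      _ ≤ (2 ^ k / 4 : ℝ) ^ N := by
          gcongr
          have : (0 : ℝ) < 2 ^ k := by positivity
          linarith
  have hI : #I ≤ A * (A + 1) := by
    refine (card_filter_le _ _).trans ?_
    simp [card_product]
  have hbox : #(Fintype.piFinset fun _ : κ => Finset.Icc (1 : ℤ) (2 ^ k)) = (2 ^ k) ^ N := by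
    have : (2 ^ k + 1 - 1 : ℤ).toNat = 2 ^ k := by
      rw [add_sub_cancel_right]
      exact_mod_cast Int.toNat_natCast (2 ^ k)
    rw [Fintype.card_piFinset, prod_const, Int.card_Icc, this, card_univ]
  have hfinal : ((2 ^ k) ^ N : ℝ) ≤ A * (A + 1) * (2 ^ k / 4 : ℝ) ^ N := by
    calc ((2 ^ k) ^ N : ℝ)
        = (#(Fintype.piFinset fun _ : κ => Finset.Icc (1 : ℤ) (2 ^ k)) : ℝ) := by
          rw [hbox]
          push_cast
          rfl
      _ ≤ (#(I.biUnion F) : ℝ) := by exact_mod_cast card_le_card hcover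
      _ ≤ ∑ p ∈ I, (#(F p) : ℝ) := by exact_mod_cast card_biUnion_le
      _ ≤ #I • (2 ^ k / 4 : ℝ) ^ N := sum_le_card_nsmul _ _ _ hF
      _ ≤ A * (A + 1) * (2 ^ k / 4 : ℝ) ^ N := by
          rw [nsmul_eq_mul]
          gcongr
          exact_mod_cast hI
  have hcountR : (A : ℝ) * (A + 1) < 4 ^ N := by exact_mod_cast hcount
  have hpos : (0 : ℝ) < (2 ^ k / 4) ^ N := by positivity
  have hprod : (4 : ℝ) ^ N * (2 ^ k / 4) ^ N = (2 ^ k) ^ N := by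
    rw [← mul_pow]
    congr 1
    ring
  nlinarith

end Counting

section Weights

lemma DyadicLevels.four_mul_pow_le_sum {ι : Type*} [Fintype ι] {c : ι → ℝ}
    {lvl : ι → ℕ} {k : ℕ} (h : DyadicLevels c lvl k) (hk : 0 < k) :
    4 * 2 ^ k ≤ ∑ i, c i := by
  calc (4 * 2 ^ k : ℝ) = ∑ i with lvl i = 1, (2 ^ k / 2 : ℝ) := by
        rw [sum_const, h.card_lvl 1 one_pos hk, nsmul_eq_mul]
        push_cast
        ring
    _ = ∑ i with lvl i = 1, c i := by
        refine sum_congr rfl fun i hi => ?_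
        have hi' : lvl i = 1 := by simpa using hi
        rw [h.eq_pow i (by omega), hi', pow_one]
    _ ≤ ∑ i, c i :=
        sum_le_sum_of_subset_of_nonneg (filter_subset _ _) fun i _ _ => (h.pos i).le

/-- The weight vector on `Fin n` with eight copies of each of `2 ^ (k - 1), …, 2, 1`, followed by
the weights `g`. -/
def dyadicWeights (n k : ℕ) (g : {i : Fin n // ¬ i.val < 8 * k} → ℤ) (i : Fin n) : ℤ :=
  if h : i.val < 8 * k then 2 ^ (k - (i.val / 8 + 1)) else g ⟨i, h⟩

/-- The levels of `dyadicWeights`. -/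
def dyadicLevel (n k : ℕ) (i : Fin n) : ℕ :=
  if i.val < 8 * k then i.val / 8 + 1 else 0

lemma dyadicLevels_dyadicWeights {n k : ℕ} (hkn : 8 * k ≤ n)
    {g : {i : Fin n // ¬ i.val < 8 * k} → ℤ} (hg : ∀ i, 1 ≤ g i ∧ g i ≤ 2 ^ k) :
    DyadicLevels (fun i => (dyadicWeights n k g i : ℝ)) (dyadicLevel n k) k := by
  have heq : ∀ i : Fin n, i.val < 8 * k →
      (dyadicWeights n k g i : ℝ) = 2 ^ k / 2 ^ dyadicLevel n k i := by
    intro i hi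
    simp only [dyadicWeights, dyadicLevel, hi, dif_pos, if_pos]
    push_cast
    rw [pow_sub₀ _ (by norm_num) (by omega), div_eq_mul_inv]
  refine ⟨fun i => ?_, fun i => ?_, fun i => ?_, fun i hi => ?_, fun s hs hsk => ?_⟩
  · by_cases hi : i.val < 8 * k
    · rw [heq i hi]
      positivity
    · simp only [dyadicWeights, hi, dif_neg, not_false_iff]
      have := (hg ⟨i, hi⟩).1
      exact_mod_cast (by omega : 0 < g ⟨i, hi⟩)
  · unfold dyadicLevel
    split_ifs <;> omega
  · by_cases hi : i.val < 8 * k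
    · exact (heq i hi).le
    · simp only [dyadicWeights, dyadicLevel, hi, dif_neg, not_false_iff, if_neg, pow_zero, div_one]
      exact_mod_cast (hg ⟨i, hi⟩).2
  · refine heq i ?_
    by_contra hcon
    simp [dyadicLevel, hcon] at hi
  · have : #{i | dyadicLevel n k i = s} = #(Finset.Ico (8 * (s - 1)) (8 * s)) := by
      refine card_bij (fun i _ => i.val) (fun i hi => ?_) (fun i _ j _ h => Fin.ext h)
        (fun b hb => ?_)
      · have hi' : dyadicLevel n k i = s := by simpa using hi
        unfold dyadicLevel at hi'
        rw [Finset.mem_Ico]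
        split_ifs at hi' <;> omega
      · rw [Finset.mem_Ico] at hb
        refine ⟨⟨b, by omega⟩, ?_, rfl⟩
        have : dyadicLevel n k ⟨b, by omega⟩ = s := by
          simp only [dyadicLevel]
          split_ifs <;> omega
        simpa using this
    rw [this, Nat.card_Ico]
    omega

lemma sum_posPart_mul_le {ι : Type*} [Fintype ι] {c : ι → ℝ} (hc : ∀ i, 0 ≤ c i) {a : ι → ℤ}
    {V : ℝ} (hV : ∀ x ∈ halfKnapsack c, ∑ i, (a i : ℝ) * x i ≤ V) :
    ∀ x ∈ halfKnapsack c, ∑ i, ((max (a i) 0 : ℤ) : ℝ) * x i ≤ V := by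
  rintro x ⟨hx, hcx⟩
  have := hV (fun i => if 0 ≤ a i then x i else 0) ⟨fun i => ?_, le_trans ?_ hcx⟩
  · refine le_trans (le_of_eq (sum_congr rfl fun i _ => ?_)) this
    split_ifs with h
    · rw [max_eq_left h]
    · rw [max_eq_right (not_le.mp h).le]
      simp
  · dsimp only
    split_ifs
    exacts [hx i, Or.inl rfl]
  · refine sum_le_sum fun i _ => mul_le_mul_of_nonneg_left ?_ (hc i)
    dsimp only
    split_ifs
    · rfl
    · rcases hx i with h | h <;> simp [h]

/-- Any integer functional separating the point `(1/2 + ε, …, 1/2 + ε)` from the knapsack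
solutions has large total. -/
def SeparatorsAreLarge {n : ℕ} (c : Fin n → ℤ) (δ₀ δ₁ η : ℝ) : Prop :=
  ∀ ε : ℝ, δ₀ ≤ ε → ε ≤ δ₁ → ∀ a : Fin n → ℤ,
    (∀ x ∈ halfKnapsack fun i => (c i : ℝ),
      ∑ i, (a i : ℝ) * x i < (1 / 2 + ε) * ∑ i, (a i : ℝ)) →
    η ≤ ε * ∑ i, (a i : ℝ)

lemma zero_mem_halfKnapsack {ι : Type*} [Fintype ι] {c : ι → ℝ} (hc : ∀ i, 0 ≤ c i) :
    (0 : ι → ℝ) ∈ halfKnapsack c :=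
  ⟨fun _ => Or.inl rfl, by simpa using div_nonneg (sum_nonneg fun i _ => hc i) zero_le_two⟩

theorem exists_weights_separatorsAreLarge {n : ℕ} (hn : 256 ≤ n) :
    ∃ c : Fin n → ℤ, (∀ i, 0 < c i ∧ c i ≤ 2 ^ (n / 16)) ∧
      SeparatorsAreLarge c (1 / 2 ^ (n / 16)) (1 / 2 ^ 16) (n / 2 ^ 18) := by
  set k := n / 16 with hkdef
  have hk : 16 ≤ k := by omega
  have hcard : Fintype.card {i : Fin n // ¬ i.val < 8 * k} = n - 8 * k := by
    rw [Fintype.card_subtype_compl, Fintype.card_fin]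
    congr 1
    have := Fin.card_filter_val_lt (n := n) (m := 8 * k)
    rw [Fintype.card_subtype, this]
    omega
  have hpow : 16 * k + 16 ≤ 2 ^ k := by
    clear hcard
    clear_value k
    clear hkdef
    induction k, hk using Nat.le_induction with
    | base => norm_num
    | succ k hk ih =>
      rw [pow_succ]
      omega
  have hcount : n * 2 ^ k * (n * 2 ^ k + 1) <
      4 ^ Fintype.card {i : Fin n // ¬ i.val < 8 * k} := by
    have h1 : n * 2 ^ k + 1 ≤ 2 ^ k * 2 ^ k := by
      have h2 : n + 1 ≤ 2 ^ k := by omega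
      nlinarith
    calc n * 2 ^ k * (n * 2 ^ k + 1) < (2 ^ k * 2 ^ k) * (2 ^ k * 2 ^ k) :=
          Nat.mul_lt_mul_of_lt_of_le (by omega) h1 (by positivity)
      _ = 4 ^ (2 * k) := by
        rw [← pow_add, ← pow_add, show (4 : ℕ) = 2 ^ 2 by norm_num, ← pow_mul]
        congr 1
        ring
      _ ≤ _ := Nat.pow_le_pow_right (by norm_num) (by omega)
  obtain ⟨g, hg, hfar⟩ := exists_badly_approximable (κ := {i : Fin n // ¬ i.val < 8 * k})
    (by omega : 0 < n) (by omega) hcount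
  have hlev := dyadicLevels_dyadicWeights (n := n) (k := k) (by omega) hg
  set c := dyadicWeights n k g with hc
  have hcpos : ∀ i, 0 < c i := fun i => by exact_mod_cast hlev.pos i
  have hcle : ∀ i, c i ≤ 2 ^ k := fun i => by
    have h1 := (hlev.le_pow i).trans (div_le_self (by positivity) (one_le_pow₀ one_le_two))
    exact_mod_cast h1
  refine ⟨c, fun i => ⟨hcpos i, hcle i⟩, ?_⟩
  intro ε hε0 hε1 a ha
  have hc0 : ∀ i, 0 ≤ (c i : ℝ) := fun i => (hlev.pos i).le
  obtain ⟨C, hC⟩ := Int.eq_ofNat_of_zero_le (sum_nonneg fun i (_ : i ∈ univ) => (hcpos i).le)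
  have hCR : ∑ i, (c i : ℝ) = C := by exact_mod_cast hC
  obtain ⟨D, hD⟩ := Int.eq_ofNat_of_zero_le
    (sum_nonneg fun i (_ : i ∈ univ) => le_max_right (a i) 0)
  have hDR : ∑ i, ((max (a i) 0 : ℤ) : ℝ) = D := by exact_mod_cast hD
  set S := ∑ i, (a i : ℝ) with hS
  have hCle : C ≤ n * 2 ^ k := by
    have := sum_le_card_nsmul univ c (2 ^ k) fun i _ => hcle i
    rw [hC] at this
    simp only [card_univ, Fintype.card_fin, nsmul_eq_mul] at this
    exact_mod_cast this
  have hpowR : (8 : ℝ) ≤ 2 ^ k := by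
    have : 8 ≤ 2 ^ k := by omega
    exact_mod_cast this
  have hCge : 4 * 2 ^ k ≤ (C : ℝ) := hCR ▸ hlev.four_mul_pow_le_sum (by omega)
  have hC8 : 8 ≤ ∑ i, (c i : ℝ) := by linarith
  have hCpos : (0 : ℝ) < C := by linarith
  have hεpos : 0 < ε := lt_of_lt_of_le (by positivity) hε0
  have hS0 : 0 < S := by
    have := ha 0 (zero_mem_halfKnapsack hc0)
    simp only [Pi.zero_apply, mul_zero, sum_const_zero] at this
    exact pos_of_mul_pos_right this (by linarith)
  have hSD : S ≤ D := by
    rw [← hDR, hS]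
    exact sum_le_sum fun i _ => by exact_mod_cast le_max_left (a i) 0
  have hDpos : (0 : ℝ) < D := by linarith
  have hV := sum_posPart_mul_le hc0 fun x hx => (ha x hx).le
  have h1 := hlev.le_of_forall_halfKnapsack hC8 hV
  have h2 := hlev.sum_abs_sub_le hC8 hV
  rw [hDR, hCR] at h1 h2
  have hinv : 1 / (C : ℝ) ≤ ε := by
    refine le_trans (one_div_le_one_div_of_le (by positivity) ?_) hε0
    linarith
  have hε4 : ε ≤ 1 / 8 := hε1.trans (by norm_num)
  have hDS : D / 4 ≤ S := by nlinarith
  by_contra! hsmall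
  have hDε : (D : ℝ) * ε < n / 2 ^ 16 := by nlinarith
  have h3 : ∑ i, |((max (a i) 0 : ℤ) : ℝ) - D / C * c i| ≤ 32 * ε * D := by
    have h4 : (D : ℝ) / C ≤ ε * D := by
      rw [div_eq_mul_one_div, mul_comm]
      gcongr
    nlinarith
  have hd : ∑ i : {i : Fin n // ¬ i.val < 8 * k}, (max (a i) 0).natAbs ≤ D := by
    have hD' : ∑ i, (max (a i) 0).natAbs = D := by
      zify
      rw [← hD]
      exact sum_congr rfl fun i _ => abs_of_nonneg (le_max_right _ _)
    rw [← hD', ← Fintype.sum_subtype_add_sum_subtype (fun i : Fin n => i.val < 8 * k)]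
    exact Nat.le_add_left _ _
  have h5 := hfar D C (by exact_mod_cast hDpos) hCle (fun i => max (a i) 0) hd ε hε0 hε1 hDε
  have h6 : ∑ i : {i : Fin n // ¬ i.val < 8 * k},
      |(C : ℝ) / D * ((max (a i) 0 : ℤ) : ℝ) - g i| ≤
      C / D * ∑ i, |((max (a i) 0 : ℤ) : ℝ) - D / C * c i| := by
    rw [← Fintype.sum_subtype_add_sum_subtype (fun i : Fin n => i.val < 8 * k), mul_add]
    refine le_trans (le_of_eq ?_) (le_add_of_nonneg_left (by positivity))
    rw [mul_sum]
    refine sum_congr rfl fun i _ => ?_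
    have hci : c i = g i := by simp [hc, dyadicWeights, i.2]
    rw [hci, ← abs_of_pos (by positivity : 0 < (C : ℝ) / D), ← abs_mul,
      abs_of_pos (by positivity : 0 < (C : ℝ) / D)]
    congr 1
    field_simp
  have h7 : (C : ℝ) / D * ∑ i, |((max (a i) 0 : ℤ) : ℝ) - D / C * c i| ≤ 32 * ε * C := by
    calc _ ≤ (C : ℝ) / D * (32 * ε * D) := by gcongr
      _ = 32 * ε * C := by field_simp
  linarith

end Weights

section Iteration

variable {n : ℕ}

lemma bddAbove_image_sum_mul {P : Set (Fin n → ℝ)} (hP : P ⊆ Set.Icc 0 1) (a : Fin n → ℤ) :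
    BddAbove ((fun y => ∑ i, (a i : ℝ) * y i) '' P) := by
  refine ⟨∑ i, |(a i : ℝ)|, ?_⟩
  rintro _ ⟨y, hy, rfl⟩
  refine sum_le_sum fun i _ => ?_
  have h0 : 0 ≤ y i := (hP hy).1 i
  have h1 : y i ≤ 1 := (hP hy).2 i
  calc (a i : ℝ) * y i ≤ |(a i : ℝ)| * y i := by gcongr; exact le_abs_self _
    _ ≤ |(a i : ℝ)| := mul_le_of_le_one_right (abs_nonneg _) h1

lemma gcClosure_subset_Icc {P : Set (Fin n → ℝ)} (hP : P ⊆ Set.Icc 0 1) :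
    gcClosure P ⊆ Set.Icc 0 1 := by
  intro x hx
  simp only [gcClosure, Set.mem_iInter] at hx
  refine ⟨fun j => ?_, fun j => ?_⟩
  · have h := hx (Pi.single j (-1))
    have hs : sSup ((fun y : Fin n → ℝ =>
        ∑ i, ((Pi.single j (-1) : Fin n → ℤ) i : ℝ) * y i) '' P) ≤ 0 := by
      refine Real.sSup_le ?_ le_rfl
      rintro _ ⟨y, hy, rfl⟩
      have : 0 ≤ y j := (hP hy).1 j
      simpa [Pi.single_apply] using this
    have h2 : ⌊sSup ((fun y : Fin n → ℝ =>
        ∑ i, ((Pi.single j (-1) : Fin n → ℤ) i : ℝ) * y i) '' P)⌋ ≤ 0 := by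
      simpa using Int.floor_mono hs
    have h3 : ∑ i, ((Pi.single j (-1) : Fin n → ℤ) i : ℝ) * x i ≤ 0 :=
      le_trans h (by exact_mod_cast h2)
    simpa [Pi.single_apply] using h3
  · have h := hx (Pi.single j 1)
    have hs : sSup ((fun y : Fin n → ℝ =>
        ∑ i, ((Pi.single j 1 : Fin n → ℤ) i : ℝ) * y i) '' P) ≤ 1 := by
      refine Real.sSup_le ?_ zero_le_one
      rintro _ ⟨y, hy, rfl⟩
      have : y j ≤ 1 := (hP hy).2 j
      simpa [Pi.single_apply] using this
    have h2 : ⌊sSup ((fun y : Fin n → ℝ =>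
        ∑ i, ((Pi.single j 1 : Fin n → ℤ) i : ℝ) * y i) '' P)⌋ ≤ 1 := by
      simpa using Int.floor_mono hs
    have h3 : ∑ i, ((Pi.single j 1 : Fin n → ℤ) i : ℝ) * x i ≤ 1 :=
      le_trans h (by exact_mod_cast h2)
    simpa [Pi.single_apply] using h3

lemma gcIter_subset_Icc {P : Set (Fin n → ℝ)} (hP : P ⊆ Set.Icc 0 1) (t : ℕ) :
    gcIter P t ⊆ Set.Icc 0 1 := by
  induction t with
  | zero => exact hP
  | succ t ih => exact gcClosure_subset_Icc ih

lemma sum_le_floor_of_integral {P : Set (Fin n → ℝ)} (hP : P ⊆ Set.Icc 0 1) {x : Fin n → ℝ}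
    (hx : x ∈ P) (hbin : ∀ i, x i = 0 ∨ x i = 1) (a : Fin n → ℤ) :
    ∑ i, (a i : ℝ) * x i ≤ (⌊sSup ((fun y => ∑ i, (a i : ℝ) * y i) '' P)⌋ : ℝ) := by
  have hle : ∑ i, (a i : ℝ) * x i ≤ sSup ((fun y => ∑ i, (a i : ℝ) * y i) '' P) :=
    le_csSup (bddAbove_image_sum_mul hP a) ⟨x, hx, rfl⟩
  obtain ⟨z, hz⟩ : ∃ z : ℤ, ∑ i, (a i : ℝ) * x i = z := by
    refine ⟨∑ i, if x i = 0 then 0 else a i, ?_⟩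
    push_cast
    refine sum_congr rfl fun i _ => ?_
    rcases hbin i with h | h <;> simp [h]
  rw [hz] at hle ⊢
  exact_mod_cast Int.le_floor.mpr hle

lemma mem_gcIter_of_integral {P : Set (Fin n → ℝ)} (hP : P ⊆ Set.Icc 0 1) {x : Fin n → ℝ}
    (hx : x ∈ P) (hbin : ∀ i, x i = 0 ∨ x i = 1) (t : ℕ) : x ∈ gcIter P t := by
  induction t with
  | zero => exact hx
  | succ t ih =>
    exact Set.mem_iInter.mpr fun a =>
      sum_le_floor_of_integral (gcIter_subset_Icc hP t) ih hbin a

/-- If all separators of the point `(1/2 + ε', …)` are large, one closure moves the diagonal point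
`(1/2 + ε, …)` no further than `(1/2 + ε', …)`. -/
lemma diagonal_mem_gcClosure {Q K : Set (Fin n → ℝ)} (hQ : Q ⊆ Set.Icc 0 1) (hKQ : K ⊆ Q)
    (hK : ∀ x ∈ K, ∀ i, x i = 0 ∨ x i = 1) {ε ε' : ℝ} (hmem : (fun _ => 1 / 2 + ε) ∈ Q)
    (hsep : ∀ a : Fin n → ℤ,
      (∀ x ∈ K, ∑ i, (a i : ℝ) * x i < (1 / 2 + ε') * ∑ i, (a i : ℝ)) →
      1 ≤ (ε - ε') * ∑ i, (a i : ℝ)) :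
    (fun _ => 1 / 2 + ε') ∈ gcClosure Q := by
  refine Set.mem_iInter.mpr fun a => ?_
  by_contra hcon
  simp only [gcCut, Set.mem_ofPred_eq, not_le, ← sum_mul] at hcon
  have hlarge := hsep a fun x hx => by
    have := sum_le_floor_of_integral hQ (hKQ hx) (hK x hx) a
    linarith
  have hle : ∑ i, (a i : ℝ) * (1 / 2 + ε) ≤ sSup ((fun y => ∑ i, (a i : ℝ) * y i) '' Q) :=
    le_csSup (bddAbove_image_sum_mul hQ a) ⟨_, hmem, rfl⟩
  rw [← sum_mul] at hle
  have hfl := Int.lt_floor_add_one (sSup ((fun y => ∑ i, (a i : ℝ) * y i) '' Q))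
  linarith

/-- The polytope spanned by the knapsack solutions and the point `(3/4, …, 3/4)`. -/
def knapsackWithApex (c : Fin n → ℝ) : Set (Fin n → ℝ) :=
  convexHull ℝ (halfKnapsack c ∪ {fun _ => (3 : ℝ) / 4})

lemma knapsackWithApex_subset_Icc (c : Fin n → ℝ) : knapsackWithApex c ⊆ Set.Icc 0 1 := by
  refine convexHull_min ?_ (convex_Icc 0 1)
  rintro x (⟨hx, -⟩ | rfl)
  · refine ⟨fun i => ?_, fun i => ?_⟩ <;> rcases hx i with h | h <;> simp [h]
  · exact ⟨fun _ => by norm_num, fun _ => by norm_num⟩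

lemma halfKnapsack_subset_knapsackWithApex (c : Fin n → ℝ) :
    halfKnapsack c ⊆ knapsackWithApex c :=
  Set.subset_union_left.trans (subset_convexHull ℝ _)

lemma diagonal_mem_knapsackWithApex {c : Fin n → ℝ} (hc : ∀ i, 0 ≤ c i) {ε : ℝ}
    (hε0 : 0 ≤ ε) (hε1 : ε ≤ 1 / 4) : (fun _ => 1 / 2 + ε) ∈ knapsackWithApex c := by
  have h0 : (0 : Fin n → ℝ) ∈ knapsackWithApex c :=
    halfKnapsack_subset_knapsackWithApex c (zero_mem_halfKnapsack hc)
  have h1 : (fun _ => (3 : ℝ) / 4) ∈ knapsackWithApex c :=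
    subset_convexHull ℝ _ (Or.inr rfl)
  have heq : (fun _ => 1 / 2 + ε) = (1 - (1 / 2 + ε) * (4 / 3)) • (0 : Fin n → ℝ) +
      ((1 / 2 + ε) * (4 / 3)) • fun _ => (3 : ℝ) / 4 := by
    ext i
    simp only [Pi.add_apply, Pi.smul_apply, Pi.zero_apply, smul_eq_mul]
    ring
  rw [heq]
  exact convex_convexHull ℝ _ h0 h1 (by linarith) (by linarith) (by ring)

lemma mem_extremePoints_Icc {x : Fin n → ℝ} (hx : ∀ i, x i = 0 ∨ x i = 1) :
    x ∈ (Set.Icc (0 : Fin n → ℝ) 1).extremePoints ℝ := by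
  refine ⟨⟨fun i => ?_, fun i => ?_⟩, ?_⟩
  · rcases hx i with h | h <;> simp [h]
  · rcases hx i with h | h <;> simp [h]
  · rintro y hy z hz ⟨α, β, hα, hβ, hαβ, rfl⟩
    ext i
    have hy0 : 0 ≤ y i := hy.1 i
    have hy1 : y i ≤ 1 := hy.2 i
    have hz0 : 0 ≤ z i := hz.1 i
    have hz1 : z i ≤ 1 := hz.2 i
    have hi := hx i
    simp only [Pi.add_apply, Pi.smul_apply, smul_eq_mul] at hi ⊢
    rcases hi with h | h <;> rw [h]
    · nlinarith [mul_nonneg hα.le hy0, mul_nonneg hβ.le hz0]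
    · nlinarith [mul_nonneg hα.le (sub_nonneg.mpr hy1), mul_nonneg hβ.le (sub_nonneg.mpr hz1)]

lemma integerHull_knapsackWithApex_le {c x : Fin n → ℝ}
    (hx : x ∈ integerHull (knapsackWithApex c)) : ∑ i, c i * x i ≤ (∑ i, c i) / 2 := by
  refine sum_mul_le_of_mem_convexHull ?_ hx
  rintro y ⟨hyP, hyint⟩
  have hbox := knapsackWithApex_subset_Icc c hyP
  have hy : ∀ i, y i = 0 ∨ y i = 1 := by
    intro i
    obtain ⟨z, hz⟩ := hyint i
    have h0 : 0 ≤ y i := hbox.1 i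
    have h1 : y i ≤ 1 := hbox.2 i
    rw [hz] at h0 h1 ⊢
    have h0' : 0 ≤ z := by exact_mod_cast h0
    have h1' : z ≤ 1 := by exact_mod_cast h1
    have : z = 0 ∨ z = 1 := by omega
    exact_mod_cast this
  have hext : y ∈ (knapsackWithApex c).extremePoints ℝ :=
    inter_extremePoints_subset_extremePoints_of_subset (knapsackWithApex_subset_Icc c)
      ⟨hyP, mem_extremePoints_Icc hy⟩
  rcases extremePoints_convexHull_subset hext with h | h
  · exact h.2
  · rcases isEmpty_or_nonempty (Fin n) with hn | ⟨⟨i⟩⟩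
    · simp
    · have h2 : y i = 3 / 4 := congrFun h i
      rcases hy i with h3 | h3 <;> rw [h3] at h2 <;> norm_num at h2

/-- If separators are large, the diagonal point shrinks towards the centre at most by the factor
`1 - 1 / η` in each round. -/
lemma diagonal_mem_gcIter {c : Fin n → ℤ} (hc : ∀ i, 0 ≤ c i) {δ₀ δ₁ η : ℝ} (hδ₀ : 0 < δ₀)
    (hδ₁ : δ₁ ≤ 1 / 4) (hη : 1 ≤ η) (hsep : SeparatorsAreLarge c δ₀ δ₁ η) (t : ℕ)
    (ht : δ₀ ≤ δ₁ * (1 - 1 / η) ^ t) :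
    (fun _ => 1 / 2 + δ₁ * (1 - 1 / η) ^ t) ∈
      gcIter (knapsackWithApex fun i => (c i : ℝ)) t := by
  have hη0 : 0 < 1 / η := by positivity
  have hη1 : 1 / η ≤ 1 := by rwa [div_le_one (by linarith)]
  have hδpos : 0 < δ₁ := by
    by_contra hneg
    have : δ₁ * (1 - 1 / η) ^ t ≤ 0 :=
      mul_nonpos_of_nonpos_of_nonneg (not_lt.mp hneg) (pow_nonneg (by linarith) _)
    linarith
  have hbox := knapsackWithApex_subset_Icc fun i => (c i : ℝ)
  induction t with
  | zero =>
    refine diagonal_mem_knapsackWithApex (fun i => by exact_mod_cast hc i) ?_ ?_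
    · simpa using hδpos.le
    · simpa using hδ₁
  | succ t ih =>
    have hpow : 0 ≤ (1 - 1 / η) ^ t := pow_nonneg (by linarith) _
    set ε := δ₁ * (1 - 1 / η) ^ t with hε
    have hε' : δ₁ * (1 - 1 / η) ^ (t + 1) = ε * (1 - 1 / η) := by rw [hε]; ring
    have hεpos : 0 ≤ ε := mul_nonneg hδpos.le hpow
    have hεle : ε ≤ δ₁ := mul_le_of_le_one_right hδpos.le (pow_le_one₀ (by linarith) (by linarith))
    rw [hε'] at ht ⊢
    have hmono : ε * (1 - 1 / η) ≤ ε := mul_le_of_le_one_right hεpos (by linarith)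
    refine diagonal_mem_gcClosure (gcIter_subset_Icc hbox t)
      (K := halfKnapsack fun i => (c i : ℝ))
      (fun x hx => mem_gcIter_of_integral hbox (halfKnapsack_subset_knapsackWithApex _ hx) hx.1 t)
      (fun x hx => hx.1) (ih (ht.trans hmono)) fun a ha => ?_
    have hlarge := hsep _ ht (hmono.trans hεle) a ha
    have hS : 0 ≤ ∑ i, (a i : ℝ) := by
      by_contra hneg
      nlinarith
    calc (1 : ℝ) = 1 / η * η := by field_simp
      _ ≤ 1 / η * (ε * (1 - 1 / η) * ∑ i, (a i : ℝ)) := by gcongr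
      _ ≤ 1 / η * (ε * ∑ i, (a i : ℝ)) := by gcongr
      _ = (ε - ε * (1 - 1 / η)) * ∑ i, (a i : ℝ) := by ring

lemma exp_neg_two_mul_le {u : ℝ} (h0 : 0 ≤ u) (h1 : u ≤ 1 / 2) : Real.exp (-(2 * u)) ≤ 1 - u := by
  rw [Real.exp_neg, inv_le_comm₀ (Real.exp_pos _) (by linarith)]
  refine le_trans ?_ (Real.add_one_le_exp (2 * u))
  rw [inv_le_iff_one_le_mul₀ (by linarith)]
  nlinarith

lemma exp_half_le_two : Real.exp (1 / 2) ≤ 2 := by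
  have h : Real.exp (1 / 2) ^ 2 = Real.exp 1 := by
    rw [← Real.exp_nat_mul]
    norm_num
  nlinarith [Real.exp_one_lt_d9, Real.exp_pos (1 / 2)]

/-- Fewer than `n ^ 2 / 2 ^ 25` rounds of shrinking by `1 - 2 ^ 18 / n` lose only a factor
exponential in `n`. -/
lemma one_div_two_pow_le (hn : 2 ^ 20 ≤ n) {t : ℕ} (ht : (t : ℝ) < 1 / 2 ^ 25 * (n : ℝ) ^ 2) :
    (1 : ℝ) / 2 ^ (n / 16) ≤ 1 / 2 ^ 16 * (1 - 1 / ((n : ℝ) / 2 ^ 18)) ^ t := by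
  have hnR : (2 ^ 20 : ℝ) ≤ n := by exact_mod_cast hn
  have hn0 : (0 : ℝ) < n := by linarith
  set u : ℝ := 1 / ((n : ℝ) / 2 ^ 18) with hu
  have hu0 : 0 ≤ u := by positivity
  have hu1 : u ≤ 1 / 2 := by
    rw [hu, div_le_iff₀ (by positivity)]
    linarith
  obtain ⟨j, hj⟩ : ∃ j, n / 16 = 16 + j := ⟨n / 16 - 16, by omega⟩
  have hjn : (n : ℝ) ≤ 32 * j := by
    have : n ≤ 32 * j := by omega
    exact_mod_cast this
  have hexp : t * (2 * u) ≤ j * (1 / 2) := by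
    calc t * (2 * u) ≤ (1 / 2 ^ 25 * (n : ℝ) ^ 2) * (2 * u) := by gcongr
      _ = n / 64 := by
        rw [hu]
        field_simp
        norm_num
      _ ≤ j * (1 / 2) := by linarith
  have h2 : Real.exp (t * (2 * u)) ≤ 2 ^ j :=
    calc Real.exp (t * (2 * u)) ≤ Real.exp (j * (1 / 2)) := Real.exp_le_exp.mpr hexp
      _ = Real.exp (1 / 2) ^ j := Real.exp_nat_mul _ _
      _ ≤ 2 ^ j := by
        gcongr
        exact exp_half_le_two
  calc (1 : ℝ) / 2 ^ (n / 16) = 1 / 2 ^ 16 * (2 ^ j)⁻¹ := by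
        rw [hj, pow_add]
        field_simp
    _ ≤ 1 / 2 ^ 16 * (Real.exp (t * (2 * u)))⁻¹ := by gcongr
    _ = 1 / 2 ^ 16 * Real.exp (-(2 * u)) ^ t := by
        rw [← Real.exp_neg, ← Real.exp_nat_mul]
        congr 2
        ring
    _ ≤ 1 / 2 ^ 16 * (1 - u) ^ t := by
        gcongr
        exact exp_neg_two_mul_le hu0 hu1

end Iteration

/-- There are a constant `γ > 0` and an integer `N` such that for every `n ≥ N` there is a
vector `c ∈ {0,…,2^⌊n/16⌋}ⁿ` for which the polytope
`P = conv({x ∈ {0,1}ⁿ : c·x ≤ ‖c‖₁/2} ∪ {(3/4,…,3/4)})` has Chvátal rank at least `γ·n²`,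
i.e. any `t` with `P⁽ᵗ⁾ = P_I` satisfies `t ≥ γ·n²`. -/
theorem chvatal_rank_quadratic_lower_bound :
    ∃ γ : ℝ, 0 < γ ∧ ∃ N : ℕ, ∀ n : ℕ, N ≤ n →
      ∃ c : Fin n → ℤ, (∀ i, 0 ≤ c i ∧ c i ≤ 2 ^ (n / 16)) ∧
        ∀ t : ℕ,
          gcIter (convexHull ℝ
              ({x : Fin n → ℝ | (∀ i, x i = 0 ∨ x i = 1) ∧
                  ∑ i, (c i : ℝ) * x i ≤ (∑ i, |(c i : ℝ)|) / 2} ∪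
                {fun _ => (3 : ℝ) / 4})) t
            = integerHull (convexHull ℝ
              ({x : Fin n → ℝ | (∀ i, x i = 0 ∨ x i = 1) ∧
                  ∑ i, (c i : ℝ) * x i ≤ (∑ i, |(c i : ℝ)|) / 2} ∪
                {fun _ => (3 : ℝ) / 4})) →
          γ * (n : ℝ) ^ 2 ≤ (t : ℝ) := by
  refine ⟨1 / 2 ^ 25, by positivity, 2 ^ 20, fun n hn => ?_⟩
  have hnR : (2 ^ 20 : ℝ) ≤ n := by exact_mod_cast hn
  obtain ⟨c, hc, hsep⟩ := exists_weights_separatorsAreLarge (n := n) (le_trans (by norm_num) hn)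
  refine ⟨c, fun i => ⟨(hc i).1.le, (hc i).2⟩, fun t ht => ?_⟩
  have habs : ∑ i, |(c i : ℝ)| = ∑ i, (c i : ℝ) :=
    sum_congr rfl fun i _ => abs_of_pos (by exact_mod_cast (hc i).1)
  rw [habs] at ht
  change gcIter (knapsackWithApex fun i => (c i : ℝ)) t =
    integerHull (knapsackWithApex fun i => (c i : ℝ)) at ht
  by_contra! hlt
  have hge := one_div_two_pow_le hn hlt
  have hmem := diagonal_mem_gcIter (fun i => (hc i).1.le) (by positivity) (by norm_num)
    (by rw [le_div_iff₀ (by positivity)]; linarith) hsep t hge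
  rw [ht] at hmem
  have hle := integerHull_knapsackWithApex_le hmem
  rw [← sum_mul] at hle
  have hpos : 0 < ∑ i, (c i : ℝ) :=
    sum_pos (fun i _ => by exact_mod_cast (hc i).1) ⟨⟨0, by omega⟩, mem_univ _⟩
  have hε : (0 : ℝ) < 1 / 2 ^ (n / 16) := by positivity
  nlinarith
end

section
/- Let δ = 1/100 and let c ∈ ℤ^n have all entries positive with ‖c‖_∞ ≤ δ·‖c‖₁. Let w ∈ ℝ^n be such that the ratios w₁/c₁ > w₂/c₂ > … > w_n/c_n are strictly decreasing, and suppose that ‖c‖₁/2 − ‖c‖_∞ ≤ Σ_{i : w_i > 0} c_i ≤ ‖c‖₁/2. Then the sum of |w_i| over all indices i with (1/2 − δ)·‖c‖₁ ≤ Σ_{j ≤ i} c_j ≤ (1/2 + δ)·‖c‖₁ is at most 9δ·‖w‖₁. -/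
open Finset
open scoped Classical

/-- If the ratios `u/c` on `A` are at most those on `B`, then the average of `u` relative to `c`
over `A` is at most that over `A ∪ B`. -/
lemma sum_mul_sum_add_le {ι : Type*} (A B : Finset ι) (u c : ι → ℝ)
    (h : ∀ i ∈ A, ∀ j ∈ B, u i * c j ≤ u j * c i) :
    (∑ i ∈ A, u i) * (∑ i ∈ A, c i + ∑ i ∈ B, c i)
      ≤ (∑ i ∈ A, c i) * (∑ i ∈ A, u i + ∑ i ∈ B, u i) := by
  have key : (∑ i ∈ A, u i) * (∑ i ∈ B, c i) ≤ (∑ i ∈ A, c i) * (∑ i ∈ B, u i) := by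
    rw [Finset.sum_mul_sum, Finset.sum_mul_sum]
    refine Finset.sum_le_sum fun i hi => Finset.sum_le_sum fun j hj => ?_
    linarith [h i hi j hj]
  linarith

/-- If `u/c` on `T` is smallest on the part satisfying `p`, and that part has `c`-weight at most
`a` while `T` has `c`-weight at least `b`, then that part has at most an `a/b` fraction
of the `u`-weight of `T`. -/
lemma sum_filter_mul_le {ι : Type*} (T : Finset ι) (p : ι → Prop) [DecidablePred p]
    (u c : ι → ℝ) (a b : ℝ)
    (hu : ∀ i, 0 ≤ u i)
    (h : ∀ i ∈ T, p i → ∀ j ∈ T, ¬ p j → u i * c j ≤ u j * c i)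
    (ha : ∑ i ∈ T.filter p, c i ≤ a) (hb : b ≤ ∑ i ∈ T, c i) :
    (∑ i ∈ T.filter p, u i) * b ≤ a * ∑ i ∈ T, u i := by
  have key := sum_mul_sum_add_le (T.filter p) (T.filter fun i => ¬ p i) u c (by
    intro i hi j hj
    rw [Finset.mem_filter] at hi hj
    exact h i hi.1 hi.2 j hj.1 hj.2)
  rw [Finset.sum_filter_add_sum_filter_not, Finset.sum_filter_add_sum_filter_not] at key
  calc (∑ i ∈ T.filter p, u i) * b ≤ (∑ i ∈ T.filter p, u i) * ∑ i ∈ T, c i :=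
        mul_le_mul_of_nonneg_left hb (Finset.sum_nonneg fun i _ => hu i)
    _ ≤ (∑ i ∈ T.filter p, c i) * ∑ i ∈ T, u i := key
    _ ≤ a * ∑ i ∈ T, u i :=
        mul_le_mul_of_nonneg_right ha (Finset.sum_nonneg fun i _ => hu i)

/-- Claim 5 of the paper. Let `δ = 1/100`, `c ∈ ℤⁿ` with positive entries and
`‖c‖_∞ ≤ δ‖c‖₁`, and let `w ∈ ℝⁿ` have strictly decreasing ratios `wᵢ/cᵢ`.
If `‖c‖₁/2 - ‖c‖_∞ ≤ Σ_{i : wᵢ>0} cᵢ ≤ ‖c‖₁/2`, then the sum of `|wᵢ|` over all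
indices `i` whose prefix sum `Σ_{j ≤ i} cⱼ` lies in `[(1/2-δ)‖c‖₁, (1/2+δ)‖c‖₁]`
is at most `9δ‖w‖₁`. -/
theorem central_window_weight_bound (n : ℕ) (c : Fin n → ℤ) (hc : ∀ i, 0 < c i)
    (hinf : ((Finset.univ.sup (fun i => (c i).natAbs) : ℕ) : ℝ)
      ≤ (1 / 100) * ∑ i, |(c i : ℝ)|)
    (w : Fin n → ℝ)
    (hmono : ∀ i j : Fin n, i < j → w j / (c j : ℝ) < w i / (c i : ℝ))
    (hlow : (∑ i, |(c i : ℝ)|) / 2 - ((Finset.univ.sup (fun i => (c i).natAbs) : ℕ) : ℝ)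
      ≤ ∑ i ∈ Finset.univ.filter (fun i => 0 < w i), (c i : ℝ))
    (hup : (∑ i ∈ Finset.univ.filter (fun i => 0 < w i), (c i : ℝ))
      ≤ (∑ i, |(c i : ℝ)|) / 2) :
    (∑ i ∈ Finset.univ.filter (fun i =>
        (1 / 2 - 1 / 100) * (∑ j, |(c j : ℝ)|)
            ≤ ∑ j ∈ Finset.univ.filter (fun j => j ≤ i), (c j : ℝ) ∧
        (∑ j ∈ Finset.univ.filter (fun j => j ≤ i), (c j : ℝ))
            ≤ (1 / 2 + 1 / 100) * (∑ j, |(c j : ℝ)|)), |w i|)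
      ≤ 9 * (1 / 100) * ∑ i, |w i| := by
  have hcR : ∀ i, (0 : ℝ) < c i := fun i => by exact_mod_cast hc i
  have hcM : ∀ i, (c i : ℝ) ≤ ((Finset.univ.sup (fun i => (c i).natAbs) : ℕ) : ℝ) := by
    intro i
    have h1 : (c i).natAbs ≤ Finset.univ.sup (fun i => (c i).natAbs) :=
      Finset.le_sup (f := fun i => (c i).natAbs) (Finset.mem_univ i)
    have h2 : c i ≤ ((c i).natAbs : ℤ) := Int.le_natAbs
    calc (c i : ℝ) ≤ (((c i).natAbs : ℤ) : ℝ) := by exact_mod_cast h2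
      _ = ((c i).natAbs : ℝ) := by rw [Int.cast_natCast]
      _ ≤ _ := by exact_mod_cast h1
  generalize ((Finset.univ.sup (fun i => (c i).natAbs) : ℕ) : ℝ) = M at *
  have habs : ∑ i, |(c i : ℝ)| = ∑ i, (c i : ℝ) :=
    Finset.sum_congr rfl fun i _ => abs_of_pos (hcR i)
  rw [habs] at hinf hlow hup ⊢
  set C : ℝ := ∑ i, (c i : ℝ)
  set S : Fin n → ℝ := fun i => ∑ j ∈ Finset.univ.filter (fun j => j ≤ i), (c j : ℝ)
  rcases Nat.eq_zero_or_pos n with rfl | hn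
  · simp
  have hCpos : 0 < C :=
    Finset.sum_pos (fun i _ => hcR i) ⟨⟨0, hn⟩, Finset.mem_univ _⟩
  have hsub : ∀ {A B : Finset (Fin n)}, A ⊆ B → ∑ i ∈ A, (c i : ℝ) ≤ ∑ i ∈ B, (c i : ℝ) :=
    fun h => Finset.sum_le_sum_of_subset_of_nonneg h fun i _ _ => (hcR i).le
  have hSmono : ∀ {i j}, i ≤ j → S i ≤ S j := fun {i j} hij => hsub fun k hk => by
    rw [Finset.mem_filter] at hk ⊢
    exact ⟨hk.1, hk.2.trans hij⟩
  have hcross : ∀ i j, i < j → w j * c i < w i * c j := fun i j hij =>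
    (div_lt_div_iff₀ (hcR j) (hcR i)).1 (hmono i j hij)
  have hinit : ∀ {i j}, i ≤ j → 0 < w j → 0 < w i := by
    intro i j hij hj
    rcases hij.lt_or_eq with h | rfl
    · have h1 := hcross i j h
      have h2 := mul_pos hj (hcR i)
      exact pos_of_mul_pos_left (h2.trans h1) (hcR j).le
    · exact hj
  set P := Finset.univ.filter (fun i => 0 < w i) with hP
  set N := Finset.univ.filter (fun i => ¬ 0 < w i) with hN
  have hPN : ∑ i ∈ P, (c i : ℝ) + ∑ i ∈ N, (c i : ℝ) = C :=
    Finset.sum_filter_add_sum_filter_not _ _ _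
  have hSP : ∀ {i}, 0 < w i → S i ≤ ∑ j ∈ P, (c j : ℝ) := fun {i} hi => hsub fun k hk => by
    rw [Finset.mem_filter] at hk ⊢
    exact ⟨hk.1, hinit hk.2 hi⟩
  have hSN : ∀ {i}, ¬ 0 < w i → ∑ j ∈ P, (c j : ℝ) ≤ S i := fun {i} hi => hsub fun k hk => by
    rw [Finset.mem_filter] at hk ⊢
    exact ⟨hk.1, le_of_not_ge fun h => hi (hinit h hk.2)⟩
  set p : Fin n → Prop :=
    fun i => (1 / 2 - 1 / 100) * C ≤ S i ∧ S i ≤ (1 / 2 + 1 / 100) * C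
  have hwP : ∑ i ∈ P.filter p, (c i : ℝ) ≤ (1 / 50) * C := by
    rcases (P.filter p).eq_empty_or_nonempty with h | h
    · rw [h, Finset.sum_empty]; positivity
    set i₀ := (P.filter p).min' h
    have hi₀ : i₀ ∈ P.filter p := Finset.min'_mem _ h
    have hmin : ∀ j ∈ P.filter p, i₀ ≤ j := fun j hj => Finset.min'_le _ j hj
    have hdisj : Disjoint ((P.filter p).erase i₀) (Finset.univ.filter (fun j => j ≤ i₀)) := by
      rw [Finset.disjoint_left]
      intro j hj hj'
      rw [Finset.mem_erase] at hj
      exact hj.1 (le_antisymm (Finset.mem_filter.1 hj').2 (hmin j hj.2))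
    have hpos : 0 < w i₀ := (Finset.mem_filter.1 (Finset.mem_filter.1 hi₀).1).2
    have h1 : ∑ i ∈ (P.filter p).erase i₀, (c i : ℝ) + S i₀ ≤ ∑ i ∈ P, (c i : ℝ) := by
      rw [← Finset.sum_union hdisj]
      refine hsub (Finset.union_subset
        ((Finset.erase_subset _ _).trans (Finset.filter_subset _ _)) fun k hk => ?_)
      rw [Finset.mem_filter] at hk ⊢
      exact ⟨hk.1, hinit hk.2 hpos⟩
    have h2 := Finset.add_sum_erase (P.filter p) (fun i => (c i : ℝ)) hi₀
    have h3 := (Finset.mem_filter.1 hi₀).2.1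
    have h4 := hcM i₀
    linarith
  have hwN : ∑ i ∈ N.filter p, (c i : ℝ) ≤ (1 / 50) * C := by
    rcases (N.filter p).eq_empty_or_nonempty with h | h
    · rw [h, Finset.sum_empty]; positivity
    set i₁ := (N.filter p).max' h
    have hi₁ : i₁ ∈ N.filter p := Finset.max'_mem _ h
    have hneg : ¬ 0 < w i₁ := (Finset.mem_filter.1 (Finset.mem_filter.1 hi₁).1).2
    have hdisj : Disjoint (N.filter p) P :=
      (Finset.disjoint_filter_filter_not _ _ _).symm.mono_left (Finset.filter_subset _ _)
    have h1 : ∑ i ∈ N.filter p, (c i : ℝ) + ∑ i ∈ P, (c i : ℝ) ≤ S i₁ := by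
      rw [← Finset.sum_union hdisj]
      refine hsub (Finset.union_subset (fun k hk => ?_) fun k hk => ?_)
      · exact Finset.mem_filter.2 ⟨Finset.mem_univ _, Finset.le_max' _ k hk⟩
      · exact Finset.mem_filter.2 ⟨Finset.mem_univ _,
          le_of_not_ge fun h => hneg (hinit h (Finset.mem_filter.1 hk).2)⟩
    have h3 := (Finset.mem_filter.1 hi₁).2.2
    linarith
  have boundP := sum_filter_mul_le P p (fun i => |w i|) (fun i => (c i : ℝ)) _ ((49 / 100) * C)
    (fun i => abs_nonneg _) (by
      intro i hi hpi j hj hpj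
      have hi' := (Finset.mem_filter.1 hi).2
      have hj' := (Finset.mem_filter.1 hj).2
      have hji : j < i := by
        by_contra hle
        have h1 := hSmono (not_lt.1 hle)
        have h2 := hSP hj'
        exact hpj ⟨hpi.1.trans h1, by linarith⟩
      simp only [abs_of_pos hi', abs_of_pos hj']
      exact (hcross j i hji).le) hwP (by linarith)
  have boundN := sum_filter_mul_le N p (fun i => |w i|) (fun i => (c i : ℝ)) _ ((49 / 100) * C)
    (fun i => abs_nonneg _) (by
      intro i hi hpi j hj hpj
      have hi' := (Finset.mem_filter.1 hi).2
      have hj' := (Finset.mem_filter.1 hj).2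
      have hij : i < j := by
        by_contra hle
        have h1 := hSmono (not_lt.1 hle)
        have h2 := hSN hj'
        exact hpj ⟨by linarith, h1.trans hpi.2⟩
      simp only [abs_of_nonpos (not_lt.1 hi'), abs_of_nonpos (not_lt.1 hj')]
      linarith [hcross i j hij]) hwN (by linarith)
  have hW : ∑ i ∈ Finset.univ.filter p, |w i|
      = ∑ i ∈ P.filter p, |w i| + ∑ i ∈ N.filter p, |w i| := by
    rw [hP, hN, Finset.filter_comm, Finset.filter_comm (fun i => ¬ 0 < w i),
      Finset.sum_filter_add_sum_filter_not]
  have htot : ∑ i ∈ P, |w i| + ∑ i ∈ N, |w i| = ∑ i, |w i| :=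
    Finset.sum_filter_add_sum_filter_not _ _ _
  have hnn : 0 ≤ ∑ i, |w i| := Finset.sum_nonneg fun i _ => abs_nonneg _
  have hfinal : (∑ i ∈ Finset.univ.filter p, |w i|) * (49 / 100) ≤ (1 / 50) * ∑ i, |w i| := by
    refine le_of_mul_le_mul_right ?_ hCpos
    rw [hW, ← htot]
    linarith
  change ∑ i ∈ Finset.univ.filter p, |w i| ≤ _
  linarith
end

section
/- Let c ∈ ℤ^n have all entries positive and let c̃ ∈ ℝ^n have all entries positive, with the ratios c̃_i/c_i pairwise distinct. Then there exists λ > 0 such that c̃_i/c_i ≠ 1/λ for every i and ‖c‖₁/2 − ‖c‖_∞ ≤ Σ_{i : c̃_i/c_i > 1/λ} c_i ≤ ‖c‖₁/2. -/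
open Finset
open scoped Classical

/-- Immediately above any real `a` there is a threshold separating `a` from all the larger values
of a finite family. -/
lemma exists_gt_forall_le_or_lt {ι : Type*} [Finite ι] (r : ι → ℝ) (a : ℝ) :
    ∃ t, a < t ∧ ∀ j, r j ≤ a ∨ t < r j := by
  have h : ∀ᶠ t in nhdsWithin a (Set.Ioi a), ∀ j, r j ≤ a ∨ t < r j := by
    refine Filter.eventually_all.2 fun j => ?_
    rcases le_or_gt (r j) a with hj | hj
    · exact Filter.Eventually.of_forall fun _ => Or.inl hj
    · filter_upwards [nhdsWithin_le_nhds (Iio_mem_nhds hj)] with t ht using Or.inr ht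
  obtain ⟨t, ht, hat⟩ := (h.and self_mem_nhdsWithin).exists
  exact ⟨t, hat, ht⟩

/-- A weighted family with distinct values has a threshold, just above one of the values `r i`,
at which the weight above the threshold is at most half of the total, and reaches half once
`w i` is added. -/
lemma exists_threshold_weighted_median {ι : Type*} [Fintype ι] [Nonempty ι] (r w : ι → ℝ)
    (hr : Function.Injective r) (hw : ∀ i, 0 ≤ w i) :
    ∃ i t, r i < t ∧ (∀ j, r j ≠ t) ∧
      (∑ j, w j) / 2 - w i ≤ ∑ j with t < r j, w j ∧
      ∑ j with t < r j, w j ≤ (∑ j, w j) / 2 := by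
  have hS : 0 ≤ ∑ j, w j := sum_nonneg fun j _ => hw j
  have hne : (univ.filter fun i => (∑ j, w j) / 2 ≤ ∑ j with r i ≤ r j, w j).Nonempty := by
    obtain ⟨i, -, hi⟩ := exists_min_image univ r univ_nonempty
    refine ⟨i, mem_filter.2 ⟨mem_univ _, ?_⟩⟩
    rw [filter_true_of_mem hi]
    linarith
  obtain ⟨i, hi, hmax⟩ := exists_max_image _ r hne
  obtain ⟨t, hit, ht⟩ := exists_gt_forall_le_or_lt r (r i)
  refine ⟨i, t, hit, fun j hj => ?_, ?_, ?_⟩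
  · rcases ht j with h | h <;> linarith
  · have hins : (univ.filter fun j => r i ≤ r j) = insert i (univ.filter fun j => t < r j) := by
      ext j
      simp only [mem_filter, mem_univ, true_and, mem_insert]
      constructor
      · intro h
        exact (ht j).imp (fun h' => hr (le_antisymm h' h)) id
      · rintro (rfl | h)
        · exact le_rfl
        · exact (hit.trans h).le
    have h := (mem_filter.1 hi).2
    rw [hins, sum_insert (by simpa using hit.le)] at h
    linarith
  · rcases (univ.filter fun j => t < r j).eq_empty_or_nonempty with h | h
    · rw [h, sum_empty]
      linarith
    · obtain ⟨j, hj, hmin⟩ := exists_min_image _ r h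
      have htj : t < r j := (mem_filter.1 hj).2
      have hfilter : (univ.filter fun k => t < r k) = univ.filter fun k => r j ≤ r k := by
        ext k
        simp only [mem_filter, mem_univ, true_and]
        exact ⟨fun hk => hmin k (by simpa using hk), htj.trans_le⟩
      rw [hfilter]
      by_contra! hlt
      exact (hit.trans htj).not_ge (hmax j (mem_filter.2 ⟨mem_univ _, hlt.le⟩))

/-- Existence of the profit threshold `1/λ` (from the proof of Lemma 4). Let `c ∈ ℤⁿ`
and `c̃ ∈ ℝⁿ` have positive entries with pairwise distinct ratios `c̃ᵢ/cᵢ`. Then there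
is `λ > 0` such that `c̃ᵢ/cᵢ ≠ 1/λ` for all `i` and
`‖c‖₁/2 - ‖c‖_∞ ≤ Σ_{i : c̃ᵢ/cᵢ > 1/λ} cᵢ ≤ ‖c‖₁/2`. -/
theorem exists_profit_threshold (n : ℕ) (c : Fin n → ℤ) (hc : ∀ i, 0 < c i)
    (ct : Fin n → ℝ) (hct : ∀ i, 0 < ct i)
    (hdistinct : ∀ i j : Fin n, i ≠ j → ct i / (c i : ℝ) ≠ ct j / (c j : ℝ)) :
    ∃ lam : ℝ, 0 < lam ∧ (∀ i, ct i / (c i : ℝ) ≠ 1 / lam) ∧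
      (∑ i, |(c i : ℝ)|) / 2 - ((Finset.univ.sup (fun i => (c i).natAbs) : ℕ) : ℝ)
          ≤ (∑ i ∈ Finset.univ.filter (fun i => 1 / lam < ct i / (c i : ℝ)), (c i : ℝ)) ∧
      (∑ i ∈ Finset.univ.filter (fun i => 1 / lam < ct i / (c i : ℝ)), (c i : ℝ))
          ≤ (∑ i, |(c i : ℝ)|) / 2 := by
  have hcR : ∀ i, (0 : ℝ) < c i := fun i => Int.cast_pos.2 (hc i)
  rcases isEmpty_or_nonempty (Fin n) with hn | hn
  · exact ⟨1, one_pos, fun i => isEmptyElim i, by simp, by simp⟩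
  obtain ⟨i, t, hit, hne, hlow, hupp⟩ := exists_threshold_weighted_median
    (fun i => ct i / (c i : ℝ)) (fun i => (c i : ℝ))
    (fun i j hij => by_contra fun h => hdistinct i j h hij) (fun i => (hcR i).le)
  have hsup : (c i : ℝ) ≤ ((univ.sup fun i => (c i).natAbs : ℕ) : ℝ) := by
    have h : (c i).natAbs ≤ univ.sup fun i => (c i).natAbs :=
      le_sup (f := fun i => (c i).natAbs) (mem_univ i)
    have h' : c i ≤ ((univ.sup fun i => (c i).natAbs : ℕ) : ℤ) := by have := hc i; omega
    exact_mod_cast h'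
  have ht : 0 < t := (div_pos (hct i) (hcR i)).trans hit
  have habs : ∑ i, |(c i : ℝ)| = ∑ i, (c i : ℝ) :=
    sum_congr rfl fun i _ => abs_of_pos (hcR i)
  refine ⟨1 / t, one_div_pos.2 ht, ?_⟩
  rw [one_div_one_div, habs]
  exact ⟨hne, by linarith, hupp⟩
end
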